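/- Assume S is everywhere positive or everywhere negative on D, so that ρ_* = ρ* =: ρ_S. If ρ_S > N and limsup_{p→∞} O_p(f,D)/N^p = +∞, then the box dimension of the graph of f exists and equals dim_B Γf = 1 + log ρ_S/log N. Otherwise (i.e., if ρ_S ≤ N or limsup_p O_p(f,D)/N^p < ∞), dim_B Γf = 2. -/

import Mathlib

open scoped BigOperators

noncomputable def oscil (φ : ℝ × ℝ → ℝ) (E : Set (ℝ × ℝ)) : ℝ :=
  sSup ((fun p : (ℝ × ℝ) × (ℝ × ℝ) => φ p.1 - φ p.2) '' (E ×ˢ E))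

noncomputable def eudist (s t : ℝ × ℝ) : ℝ :=
  Real.sqrt ((s.1 - t.1) ^ 2 + (s.2 - t.2) ^ 2)

noncomputable def uMap (x0 len : ℝ) (N : ℕ) (i : Fin N) (x : ℝ) : ℝ :=
  if i.val % 2 = 0 then x0 + i.val * (len / N) + (x - x0) / N
  else x0 + (i.val + 1) * (len / N) - (x - x0) / N

noncomputable def uInv (x0 len : ℝ) (N : ℕ) (i : Fin N) (y : ℝ) : ℝ :=
  if i.val % 2 = 0 then x0 + N * (y - (x0 + i.val * (len / N)))
  else x0 + N * ((x0 + (i.val + 1) * (len / N)) - y)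

noncomputable def Lmap (x0 y0 len : ℝ) (N : ℕ) (w : Fin N × Fin N) (t : ℝ × ℝ) : ℝ × ℝ :=
  (uMap x0 len N w.1 t.1, uMap y0 len N w.2 t.2)

noncomputable def LInv (x0 y0 len : ℝ) (N : ℕ) (w : Fin N × Fin N) (t : ℝ × ℝ) : ℝ × ℝ :=
  (uInv x0 len N w.1 t.1, uInv y0 len N w.2 t.2)

noncomputable def sqD (x0 y0 len : ℝ) : Set (ℝ × ℝ) :=
  Set.Icc x0 (x0 + len) ×ˢ Set.Icc y0 (y0 + len)

noncomputable def cell (x0 y0 len : ℝ) (N : ℕ) : List (Fin N × Fin N) → Set (ℝ × ℝ)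
  | [] => sqD x0 y0 len
  | w :: ws => Lmap x0 y0 len N w '' cell x0 y0 len N ws

noncomputable def oscSum (x0 y0 len : ℝ) (N : ℕ) (φ : ℝ × ℝ → ℝ)
    (p : List (Fin N × Fin N)) (k : ℕ) : ℝ :=
  ∑ w : Fin k → Fin N × Fin N, oscil φ (cell x0 y0 len N (p ++ List.ofFn w))

noncomputable def supAbs (S : ℝ × ℝ → ℝ) (E : Set (ℝ × ℝ)) : ℝ :=
  sSup ((fun t => |S t|) '' E)

noncomputable def infAbs (S : ℝ × ℝ → ℝ) (E : Set (ℝ × ℝ)) : ℝ :=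
  sInf ((fun t => |S t|) '' E)

open Classical in
noncomputable def upMat (x0 y0 len : ℝ) (N : ℕ) (S : ℝ × ℝ → ℝ) (m : ℕ) :
    Matrix (Fin (m + 1) → Fin N × Fin N) (Fin (m + 1) → Fin N × Fin N) ℝ :=
  fun i j =>
    if ∀ k : Fin m, i k.succ = j k.castSucc then
      supAbs S (cell x0 y0 len N (List.ofFn i ++ [j (Fin.last m)]))
    else 0

open Classical in
noncomputable def lowMat (x0 y0 len : ℝ) (N : ℕ) (S : ℝ × ℝ → ℝ) (m : ℕ) :
    Matrix (Fin (m + 1) → Fin N × Fin N) (Fin (m + 1) → Fin N × Fin N) ℝ :=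
  fun i j =>
    if ∀ k : Fin m, i k.succ = j k.castSucc then
      infAbs S (cell x0 y0 len N (List.ofFn i ++ [j (Fin.last m)]))
    else 0

noncomputable def specRad {α : Type*} [Fintype α] [DecidableEq α] (A : Matrix α α ℝ) : ENNReal :=
  spectralRadius ℂ (A.map (fun x : ℝ => (x : ℂ)))

noncomputable def cubeCount (E : Set (ℝ × ℝ × ℝ)) (ε : ℝ) : ℕ :=
  Nat.card {n : ℤ × ℤ × ℤ |
    (((Set.Icc ((n.1 : ℝ) * ε) (((n.1 : ℝ) + 1) * ε)) ×ˢ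
      ((Set.Icc ((n.2.1 : ℝ) * ε) (((n.2.1 : ℝ) + 1) * ε)) ×ˢ
        (Set.Icc ((n.2.2 : ℝ) * ε) (((n.2.2 : ℝ) + 1) * ε)))) ∩ E).Nonempty}

noncomputable def ubDim (E : Set (ℝ × ℝ × ℝ)) : ℝ :=
  Filter.limsup (fun ε : ℝ => Real.log (cubeCount E ε) / Real.log (1 / ε))
    (nhdsWithin 0 (Set.Ioi 0))

noncomputable def lbDim (E : Set (ℝ × ℝ × ℝ)) : ℝ :=
  Filter.liminf (fun ε : ℝ => Real.log (cubeCount E ε) / Real.log (1 / ε))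
    (nhdsWithin 0 (Set.Ioi 0))

def graphOn (f : ℝ × ℝ → ℝ) (D : Set (ℝ × ℝ)) : Set (ℝ × ℝ × ℝ) :=
  {p | (p.1, p.2.1) ∈ D ∧ p.2.2 = f (p.1, p.2.1)}

section Cells

variable {x0 y0 len : ℝ} {N : ℕ}

/-- The position, among the `N ^ k` consecutive intervals of level `k`, of the interval coded by a
word of length `k`. -/
def gridIndex (N : ℕ) : List (Fin N) → ℕ
  | [] => 0
  | w :: ws =>
    if w.val % 2 = 0 then w.val * N ^ ws.length + gridIndex N ws
    else w.val * N ^ ws.length + (N ^ ws.length - 1 - gridIndex N ws)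

lemma gridIndex_lt (ws : List (Fin N)) : gridIndex N ws < N ^ ws.length := by
  induction ws with
  | nil => simp [gridIndex]
  | cons w ws ih =>
    have hw : w.val + 1 ≤ N := w.isLt
    have h : (w.val + 1) * N ^ ws.length ≤ N * N ^ ws.length := Nat.mul_le_mul_right _ hw
    rw [add_mul, one_mul] at h
    rw [gridIndex, List.length_cons, pow_succ']
    split_ifs <;> omega

lemma gridIndex_injective (v w : List (Fin N)) (hl : v.length = w.length)
    (h : gridIndex N v = gridIndex N w) : v = w := by
  induction v generalizing w with
  | nil => exact (List.length_eq_zero_iff.1 hl.symm).symm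
  | cons a v ih =>
    cases w with
    | nil => simp at hl
    | cons b w =>
      have hl' : v.length = w.length := by simpa using hl
      have hv := gridIndex_lt v
      have hw := gridIndex_lt w
      rw [gridIndex, gridIndex, ← hl'] at h
      rw [← hl'] at hw
      set P := N ^ v.length
      have hdiv : ∀ c r : ℕ, r < P → (c * P + r) / P = c := fun c r hr => by
        rw [mul_comm, Nat.mul_add_div (by omega), Nat.div_eq_of_lt hr, add_zero]
      have hab : a = b := by
        apply Fin.ext
        have h' := congrArg (· / P) h
        split_ifs at h' <;>
          rwa [hdiv _ _ (by omega), hdiv _ _ (by omega)] at h'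
      subst hab
      have : gridIndex N v = gridIndex N w := by
        split_ifs at h <;> omega
      rw [ih w hl' this]

lemma uMap_mem_interval (hN : 0 < N) (a : Fin N) (ws : List (Fin N)) {x : ℝ}
    (hx : x ∈ Set.Icc (x0 + gridIndex N ws * (len / N ^ ws.length))
      (x0 + (gridIndex N ws + 1) * (len / N ^ ws.length))) :
    uMap x0 len N a x ∈ Set.Icc (x0 + gridIndex N (a :: ws) * (len / N ^ (a :: ws).length))
      (x0 + (gridIndex N (a :: ws) + 1) * (len / N ^ (a :: ws).length)) := by
  have hNr : (0 : ℝ) < N := by exact_mod_cast hN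
  have hlt := gridIndex_lt ws
  obtain ⟨h1, h2⟩ := hx
  have hP : (0 : ℝ) < (N : ℝ) ^ ws.length := by positivity
  set k := gridIndex N ws with hk
  have e1 : len / (N : ℝ) ^ (a :: ws).length = (len / N ^ ws.length) / N := by
    rw [List.length_cons, pow_succ, div_div]
  have e2 : len / (N : ℝ) = N ^ ws.length * ((len / N ^ ws.length) / N) := by
    field_simp
  set δ := len / (N : ℝ) ^ ws.length with hδ
  have h1' : (k : ℝ) * (δ / N) ≤ (x - x0) / N := by
    rw [← mul_div_assoc]; gcongr; linarith
  have h2' : (x - x0) / N ≤ (k + 1 : ℝ) * (δ / N) := by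
    rw [← mul_div_assoc]; gcongr; linarith
  rw [e1, uMap, gridIndex, ← hk, e2]
  split_ifs with hpar
  · push_cast
    constructor <;> nlinarith
  · rw [Nat.sub_sub, Nat.cast_add, Nat.cast_mul, Nat.cast_sub (by omega)]
    push_cast
    constructor <;> nlinarith

lemma cell_subset_grid (hN : 0 < N) (ws : List (Fin N × Fin N)) :
    cell x0 y0 len N ws ⊆
      Set.Icc (x0 + gridIndex N (ws.map Prod.fst) * (len / N ^ ws.length))
        (x0 + (gridIndex N (ws.map Prod.fst) + 1) * (len / N ^ ws.length)) ×ˢ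
      Set.Icc (y0 + gridIndex N (ws.map Prod.snd) * (len / N ^ ws.length))
        (y0 + (gridIndex N (ws.map Prod.snd) + 1) * (len / N ^ ws.length)) := by
  induction ws with
  | nil => simp [cell, sqD, gridIndex]
  | cons a ws ih =>
    rintro _ ⟨t, ht, rfl⟩
    obtain ⟨h1, h2⟩ := ih ht
    constructor
    · simpa [Lmap] using uMap_mem_interval (x0 := x0) (len := len) hN a.1 (ws.map Prod.fst)
        (by simpa using h1)
    · simpa [Lmap] using uMap_mem_interval (x0 := y0) (len := len) hN a.2 (ws.map Prod.snd)
        (by simpa using h2)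

lemma uMap_mapsTo (hN : 0 < N) (a : Fin N) {x : ℝ} (hx : x ∈ Set.Icc x0 (x0 + len)) :
    uMap x0 len N a x ∈ Set.Icc x0 (x0 + len) := by
  have hNr : (0 : ℝ) < N := by exact_mod_cast hN
  have ha : (a.val : ℝ) + 1 ≤ N := by exact_mod_cast a.isLt
  have hlen : 0 ≤ len := by linarith [hx.1, hx.2]
  have hd : 0 ≤ len / (N : ℝ) := by positivity
  have h1 : 0 ≤ (x - x0) / N := div_nonneg (by linarith [hx.1]) hNr.le
  have h2 : (x - x0) / N ≤ len / N := by gcongr; linarith [hx.2]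
  have h3 : ((a.val : ℝ) + 1) * (len / N) ≤ len := by
    calc ((a.val : ℝ) + 1) * (len / N) ≤ N * (len / N) := by gcongr
      _ = len := by field_simp
  have h4 : 0 ≤ (a.val : ℝ) * (len / N) := by positivity
  rw [uMap]
  split_ifs <;> constructor <;> nlinarith

lemma Lmap_mapsTo (hN : 0 < N) (a : Fin N × Fin N) {t : ℝ × ℝ} (ht : t ∈ sqD x0 y0 len) :
    Lmap x0 y0 len N a t ∈ sqD x0 y0 len :=
  ⟨uMap_mapsTo hN a.1 ht.1, uMap_mapsTo hN a.2 ht.2⟩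

lemma cell_subset_sqD (hN : 0 < N) (ws : List (Fin N × Fin N)) :
    cell x0 y0 len N ws ⊆ sqD x0 y0 len := by
  induction ws with
  | nil => exact subset_rfl
  | cons a ws ih =>
    rintro _ ⟨t, ht, rfl⟩
    exact Lmap_mapsTo hN a (ih ht)

lemma cell_append_subset (hN : 0 < N) (u v : List (Fin N × Fin N)) :
    cell x0 y0 len N (u ++ v) ⊆ cell x0 y0 len N u := by
  induction u with
  | nil => exact cell_subset_sqD hN v
  | cons a u ih => exact Set.image_mono ih

lemma continuous_Lmap (a : Fin N × Fin N) : Continuous (Lmap x0 y0 len N a) := by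
  have h : ∀ (z : ℝ) (i : Fin N), Continuous (uMap z len N i) := fun z i => by
    unfold uMap
    split_ifs <;> fun_prop
  exact ((h x0 a.1).comp continuous_fst).prodMk ((h y0 a.2).comp continuous_snd)

lemma isCompact_cell (ws : List (Fin N × Fin N)) : IsCompact (cell x0 y0 len N ws) := by
  induction ws with
  | nil => exact isCompact_Icc.prod isCompact_Icc
  | cons a ws ih => exact ih.image (continuous_Lmap a)

lemma isPreconnected_cell (ws : List (Fin N × Fin N)) :
    IsPreconnected (cell x0 y0 len N ws) := by
  induction ws with
  | nil => exact isPreconnected_Icc.prod isPreconnected_Icc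
  | cons a ws ih => exact ih.image _ (continuous_Lmap a).continuousOn

lemma cell_nonempty (hlen : 0 < len) (ws : List (Fin N × Fin N)) :
    (cell x0 y0 len N ws).Nonempty := by
  induction ws with
  | nil => exact ⟨(x0, y0), ⟨le_rfl, by linarith⟩, ⟨le_rfl, by linarith⟩⟩
  | cons a ws ih => exact ih.image _

lemma LInv_Lmap (hN : 0 < N) (a : Fin N × Fin N) (t : ℝ × ℝ) :
    LInv x0 y0 len N a (Lmap x0 y0 len N a t) = t := by
  have hNr : (N : ℝ) ≠ 0 := by positivity
  have h : ∀ (z x : ℝ) (i : Fin N), uInv z len N i (uMap z len N i x) = x := fun z x i => by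
    unfold uInv uMap
    split_ifs
    · rw [add_sub_cancel_left, mul_div_cancel₀ _ hNr]; ring
    · rw [sub_sub_cancel, mul_div_cancel₀ _ hNr]; ring
  exact Prod.ext (h _ _ _) (h _ _ _)

lemma exists_uMap_eq (hlen : 0 < len) (hN : 0 < N) {x : ℝ} (hx : x ∈ Set.Icc x0 (x0 + len)) :
    ∃ i : Fin N, ∃ z ∈ Set.Icc x0 (x0 + len), uMap x0 len N i z = x := by
  have hNr : (0 : ℝ) < N := by exact_mod_cast hN
  obtain ⟨y, hy⟩ : ∃ y, y = (x - x0) * N / len := ⟨_, rfl⟩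
  have hxy : x = x0 + y * (len / N) := by rw [hy]; field_simp; ring
  have hy0 : 0 ≤ y := by
    rw [hy]; exact div_nonneg (mul_nonneg (by linarith [hx.1]) hNr.le) hlen.le
  have hyN : y ≤ N := by
    rw [hy, div_le_iff₀ hlen, mul_comm]
    gcongr
    linarith [hx.2]
  obtain ⟨i, hiN, hi1, hi2⟩ : ∃ i : ℕ, i < N ∧ (i : ℝ) ≤ y ∧ y ≤ i + 1 := by
    rcases lt_or_ge ⌊y⌋₊ N with h | h
    · exact ⟨⌊y⌋₊, h, Nat.floor_le hy0, (Nat.lt_floor_add_one y).le⟩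
    · have : (N : ℝ) ≤ y := (Nat.cast_le.2 h).trans (Nat.floor_le hy0)
      refine ⟨N - 1, by omega, ?_, ?_⟩ <;> rw [Nat.cast_sub (by omega)] <;> push_cast <;> linarith
  refine ⟨⟨i, hiN⟩, if i % 2 = 0 then x0 + (y - i) * len else x0 + (i + 1 - y) * len, ?_, ?_⟩
  · split_ifs <;> constructor <;> nlinarith
  · rw [uMap, hxy]
    dsimp only
    split_ifs <;> field_simp <;> ring

lemma exists_mem_cell (hlen : 0 < len) (hN : 0 < N) (k : ℕ) {t : ℝ × ℝ}
    (ht : t ∈ sqD x0 y0 len) :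
    ∃ w : Fin k → Fin N × Fin N, t ∈ cell x0 y0 len N (List.ofFn w) := by
  induction k generalizing t with
  | zero => exact ⟨Fin.elim0, by simpa [cell] using ht⟩
  | succ k ih =>
    obtain ⟨i, z, hz, hi⟩ := exists_uMap_eq hlen hN ht.1
    obtain ⟨j, z', hz', hj⟩ := exists_uMap_eq hlen hN ht.2
    obtain ⟨w, hw⟩ := ih (t := (z, z')) ⟨hz, hz'⟩
    refine ⟨Fin.cons (i, j) w, ?_⟩
    rw [List.ofFn_cons]
    exact ⟨(z, z'), hw, Prod.ext hi hj⟩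

lemma eudist_le_of_mem_cell (hN : 0 < N) {ws : List (Fin N × Fin N)} {s t : ℝ × ℝ}
    (hs : s ∈ cell x0 y0 len N ws) (ht : t ∈ cell x0 y0 len N ws) :
    eudist s t ≤ 2 * (len / N ^ ws.length) := by
  obtain ⟨⟨a1, a2⟩, ⟨a3, a4⟩⟩ := cell_subset_grid hN ws hs
  obtain ⟨⟨b1, b2⟩, ⟨b3, b4⟩⟩ := cell_subset_grid hN ws ht
  set δ := len / (N : ℝ) ^ ws.length
  have h1 : |s.1 - t.1| ≤ δ := abs_le.2 ⟨by linarith, by linarith⟩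
  have h2 : |s.2 - t.2| ≤ δ := abs_le.2 ⟨by linarith, by linarith⟩
  have hδ : 0 ≤ δ := (abs_nonneg _).trans h1
  rw [eudist, Real.sqrt_le_left (by positivity)]
  nlinarith [sq_le_sq' (abs_le.1 h1).1 (abs_le.1 h1).2, sq_le_sq' (abs_le.1 h2).1 (abs_le.1 h2).2]

end Cells

section Oscillation

variable {x0 y0 len : ℝ} {N : ℕ}

lemma exists_oscil_eq {φ : ℝ × ℝ → ℝ} {E : Set (ℝ × ℝ)} (hE : IsCompact E) (hne : E.Nonempty)
    (hφ : ContinuousOn φ E) :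
    ∃ a ∈ E, ∃ b ∈ E, (∀ t ∈ E, φ t ∈ Set.Icc (φ a) (φ b)) ∧ oscil φ E = φ b - φ a := by
  obtain ⟨a, ha, hmin⟩ := hE.exists_isMinOn hne hφ
  obtain ⟨b, hb, hmax⟩ := hE.exists_isMaxOn hne hφ
  refine ⟨a, ha, b, hb, fun t ht => ⟨hmin ht, hmax ht⟩, ?_⟩
  refine IsGreatest.csSup_eq ⟨⟨(b, a), ⟨hb, ha⟩, rfl⟩, ?_⟩
  rintro _ ⟨⟨s, t⟩, ⟨hs, ht⟩, rfl⟩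
  exact sub_le_sub (hmax hs) (hmin ht)

lemma supAbs_mem_bound {S : ℝ × ℝ → ℝ} {D E : Set (ℝ × ℝ)} (hS1 : ∀ t ∈ D, |S t| < 1)
    (hED : E ⊆ D) {t : ℝ × ℝ} (ht : t ∈ E) : |S t| ≤ supAbs S E :=
  le_csSup ⟨1, by rintro _ ⟨s, hs, rfl⟩; exact (hS1 s (hED hs)).le⟩ ⟨t, ht, rfl⟩

lemma supAbs_nonneg (S : ℝ × ℝ → ℝ) (E : Set (ℝ × ℝ)) : 0 ≤ supAbs S E :=
  Real.sSup_nonneg (by rintro _ ⟨s, _, rfl⟩; exact abs_nonneg _)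

lemma supAbs_le_one {S : ℝ × ℝ → ℝ} {D E : Set (ℝ × ℝ)} (hS1 : ∀ t ∈ D, |S t| < 1)
    (hED : E ⊆ D) : supAbs S E ≤ 1 :=
  Real.sSup_le (by rintro _ ⟨s, hs, rfl⟩; exact (hS1 s (hED hs)).le) zero_le_one

lemma infAbs_nonneg (S : ℝ × ℝ → ℝ) (E : Set (ℝ × ℝ)) : 0 ≤ infAbs S E :=
  Real.sInf_nonneg (by rintro _ ⟨s, _, rfl⟩; exact abs_nonneg _)

lemma infAbs_le {S : ℝ × ℝ → ℝ} {E : Set (ℝ × ℝ)} {t : ℝ × ℝ} (ht : t ∈ E) :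
    infAbs S E ≤ |S t| :=
  csInf_le ⟨0, by rintro _ ⟨s, _, rfl⟩; exact abs_nonneg _⟩ ⟨t, ht, rfl⟩

lemma infAbs_pos {S : ℝ × ℝ → ℝ} {E : Set (ℝ × ℝ)} (hE : IsCompact E) (hne : E.Nonempty)
    (hS : ContinuousOn S E) (h0 : ∀ t ∈ E, S t ≠ 0) : 0 < infAbs S E := by
  obtain ⟨a, ha, hmin⟩ := hE.exists_isMinOn hne hS.abs
  refine (abs_pos.2 (h0 a ha)).trans_le (le_csInf (hne.image _) ?_)
  rintro _ ⟨s, hs, rfl⟩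
  exact hmin hs

lemma continuousOn_of_abs_sub_le_eudist {S : ℝ × ℝ → ℝ} {E : Set (ℝ × ℝ)} {c : ℝ}
    (h : ∀ t₁ ∈ E, ∀ t₂ ∈ E, |S t₁ - S t₂| ≤ c * eudist t₁ t₂) : ContinuousOn S E := by
  intro t ht
  have hc : Filter.Tendsto (fun s => c * eudist s t) (nhdsWithin t E) (nhds 0) := by
    have : Continuous fun s => c * eudist s t := by unfold eudist; fun_prop
    have h' := this.tendsto t
    simp only [eudist, sub_self] at h'
    refine Filter.Tendsto.mono_left ?_ nhdsWithin_le_nhds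
    simpa [eudist] using h'
  rw [ContinuousWithinAt, tendsto_iff_dist_tendsto_zero]
  refine squeeze_zero' (Filter.Eventually.of_forall fun _ => dist_nonneg) ?_ hc
  filter_upwards [self_mem_nhdsWithin] with s hs
  exact h s hs t ht

lemma oscSum_succ (φ : ℝ × ℝ → ℝ) (p : List (Fin N × Fin N)) (k : ℕ) :
    oscSum x0 y0 len N φ p (k + 1) = ∑ a, oscSum x0 y0 len N φ (p ++ [a]) k := by
  unfold oscSum
  rw [← (Fin.consEquiv fun _ : Fin (k + 1) => Fin N × Fin N).sum_comp, Fintype.sum_prod_type]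
  simp [Fin.consEquiv]

lemma ofFn_snoc {A : Type*} {m : ℕ} (i : Fin m → A) (a : A) :
    List.ofFn (Fin.snoc (α := fun _ => A) i a) = List.ofFn i ++ [a] := by
  rw [List.ofFn_succ', List.concat_eq_append]
  simp

lemma sum_oscSum_ofFn (φ : ℝ × ℝ → ℝ) (m k : ℕ) :
    ∑ i : Fin m → Fin N × Fin N, oscSum x0 y0 len N φ (List.ofFn i) k =
      oscSum x0 y0 len N φ [] (m + k) := by
  induction m generalizing k with
  | zero => simp
  | succ m ih =>
    rw [show m + 1 + k = m + (k + 1) by omega, ← ih (k + 1),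
      ← (Fin.snocEquiv fun _ : Fin (m + 1) => Fin N × Fin N).sum_comp, Fintype.sum_prod_type,
      Finset.sum_comm]
    refine Finset.sum_congr rfl fun i _ => ?_
    rw [oscSum_succ]
    exact Finset.sum_congr rfl fun a _ => by rw [← ofFn_snoc]; rfl

/-- The extensions of the shifted word `Fin.tail i` by one letter are the words compatible with
`i`. -/
lemma sum_compatible {A : Type*} [Fintype A] {m : ℕ} (i : Fin (m + 1) → A)
    (g : (Fin (m + 1) → A) → ℝ)
    [∀ j : Fin (m + 1) → A, Decidable (∀ k : Fin m, i k.succ = j k.castSucc)] :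
    (∑ j : Fin (m + 1) → A, if ∀ k : Fin m, i k.succ = j k.castSucc then g j else 0) =
      ∑ a : A, g (Fin.snoc (α := fun _ => A) (Fin.tail i) a) := by
  classical
  rw [← Finset.sum_filter]
  refine Finset.sum_bij' (fun j _ => j (Fin.last m))
    (fun a _ => Fin.snoc (α := fun _ => A) (Fin.tail i) a) (by simp)
    (by simp [Fin.tail]) ?_ (by simp) ?_
  all_goals
    intro j hj
    have hj' : Fin.tail i = Fin.init j := by
      ext k : 1
      exact (Finset.mem_filter.1 hj).2 k
    simp [hj', Fin.snoc_init_self]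

end Oscillation

section Matrices

variable {ι : Type*} [Fintype ι] [DecidableEq ι]

attribute [local instance] Matrix.linftyOpNormedRing Matrix.linftyOpNormedAlgebra

lemma linfty_row_le (B : Matrix ι ι ℂ) (i : ι) : ∑ j, ‖B i j‖ ≤ ‖B‖ := by
  rw [Matrix.linfty_opNorm_def]
  have h := Finset.le_sup (f := fun i => ∑ j, ‖B i j‖₊) (Finset.mem_univ i)
  have h' := NNReal.coe_le_coe.2 h
  simpa using h'

lemma map_ofReal_pow (A : Matrix ι ι ℝ) (n : ℕ) :
    (A.map fun x : ℝ => (x : ℂ)) ^ n = (A ^ n).map fun x : ℝ => (x : ℂ) :=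
  (map_pow Complex.ofRealHom.mapMatrix A n).symm

lemma specRad_le_of_row_sum_le {A : Matrix ι ι ℝ} (hA : ∀ i j, 0 ≤ A i j) {R : ℝ} (hR : 0 ≤ R)
    (h : ∀ i, ∑ j, A i j ≤ R) : specRad A ≤ ENNReal.ofReal R := by
  rcases isEmpty_or_nonempty ι with hι | hι
  · simp [specRad, spectralRadius, spectrum.of_subsingleton]
  have : CompleteSpace (Matrix ι ι ℂ) := FiniteDimensional.complete ℂ _
  refine (spectrum.spectralRadius_le_nnnorm _).trans ?_
  rw [ENNReal.ofReal, ENNReal.coe_le_coe, Matrix.linfty_opNNNorm_def]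
  refine Finset.sup_le fun i _ => ?_
  rw [← NNReal.coe_le_coe, Real.coe_toNNReal _ hR]
  simpa [abs_of_nonneg (hA i _)] using h i

lemma exists_row_sum_pow_le {A : Matrix ι ι ℝ} {R : ℝ} (hR : 0 < R)
    (h : specRad A < ENNReal.ofReal R) : ∃ n ≠ 0, ∀ i, ∑ j, (A ^ n) i j ≤ R ^ n := by
  have : CompleteSpace (Matrix ι ι ℂ) := FiniteDimensional.complete ℂ _
  have ht := spectrum.pow_nnnorm_pow_one_div_tendsto_nhds_spectralRadius
    (A.map fun x : ℝ => (x : ℂ))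
  obtain ⟨n, hn, hn0⟩ := ((ht.eventually_lt_const h).and (Filter.eventually_ne_atTop 0)).exists
  refine ⟨n, hn0, fun i => ?_⟩
  have h1 : ‖(A.map fun x : ℝ => (x : ℂ)) ^ n‖ ≤ R ^ n := by
    have h2 := ENNReal.rpow_le_rpow hn.le (Nat.cast_nonneg n)
    rw [← ENNReal.rpow_mul, one_div_mul_cancel (by exact_mod_cast hn0), ENNReal.rpow_one,
      ENNReal.rpow_natCast, ← ENNReal.ofReal_pow hR.le, ENNReal.ofReal,
      ENNReal.coe_le_coe, ← NNReal.coe_le_coe, Real.coe_toNNReal _ (by positivity)] at h2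
    exact h2
  rw [map_ofReal_pow] at h1
  refine le_trans ?_ ((linfty_row_le _ i).trans h1)
  refine Finset.sum_le_sum fun j _ => ?_
  rw [Matrix.map_apply, Complex.norm_real]
  exact le_abs_self _

lemma pow_le_sum_pow {A : Matrix ι ι ℝ} (hA : ∀ i j, 0 ≤ A i j) {R : ℝ} (hR : 0 < R)
    (h : ENNReal.ofReal R < specRad A) (n : ℕ) :
    R ^ (n + 1) ≤ ∑ i, ∑ j, (A ^ (n + 1)) i j := by
  rcases isEmpty_or_nonempty ι with hι | hι
  · simp [specRad, spectralRadius, spectrum.of_subsingleton] at h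
  have : CompleteSpace (Matrix ι ι ℂ) := FiniteDimensional.complete ℂ _
  have h1 := h.le.trans
    (spectrum.spectralRadius_le_pow_nnnorm_pow_one_div ℂ (A.map fun x : ℝ => (x : ℂ)) n)
  rw [nnnorm_one, ENNReal.coe_one, ENNReal.one_rpow, mul_one] at h1
  have h2 := ENNReal.rpow_le_rpow h1 (Nat.cast_nonneg (n + 1))
  have hn0 : (n : ℝ) + 1 ≠ 0 := by positivity
  rw [← ENNReal.rpow_mul, Nat.cast_add_one, one_div_mul_cancel hn0, ENNReal.rpow_one,
    ← Nat.cast_add_one, ENNReal.rpow_natCast, ← ENNReal.ofReal_pow hR.le, ENNReal.ofReal,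
    ENNReal.coe_le_coe, ← NNReal.coe_le_coe, Real.coe_toNNReal _ (by positivity)] at h2
  refine h2.trans ?_
  have hnn : ∀ i j, 0 ≤ (A ^ (n + 1)) i j := by
    intro i j
    exact Matrix.pow_apply_nonneg hA (n + 1) i j
  rw [map_ofReal_pow, coe_nnnorm, Matrix.linfty_opNorm_def]
  obtain ⟨i, -, hi⟩ := Finset.exists_mem_eq_sup Finset.univ Finset.univ_nonempty
    fun i => ∑ j, ‖((A ^ (n + 1)).map fun x : ℝ => (x : ℂ)) i j‖₊
  rw [hi]
  simp only [Matrix.map_apply, NNReal.coe_sum, coe_nnnorm, Complex.norm_real, Real.norm_eq_abs,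
    abs_of_nonneg (hnn _ _)]
  exact Finset.single_le_sum (f := fun i => ∑ j, (A ^ (n + 1)) i j)
    (fun i _ => Finset.sum_nonneg fun j _ => hnn i j) (Finset.mem_univ i)

/-- The truncated Neumann series of `(1 - R⁻¹ A)⁻¹` applied to the constant vector `1`. -/
noncomputable def neumannSum (A : Matrix ι ι ℝ) (R : ℝ) (n : ℕ) : ι → ℝ :=
  ∑ k ∈ Finset.range n, R⁻¹ ^ k • Matrix.mulVec (A ^ k) 1

lemma one_le_neumannSum {A : Matrix ι ι ℝ} (hA : ∀ i j, 0 ≤ A i j) {R : ℝ} (hR : 0 < R) {n : ℕ}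
    (hn : n ≠ 0) (i : ι) : 1 ≤ neumannSum A R n i := by
  have h := Finset.single_le_sum
    (f := fun k => (R⁻¹ ^ k • Matrix.mulVec (A ^ k) (1 : ι → ℝ)) i) (s := Finset.range n)
    (fun k _ => by
      simp only [Pi.smul_apply, smul_eq_mul, Matrix.mulVec, dotProduct, Pi.one_apply, mul_one]
      exact mul_nonneg (by positivity)
        (Finset.sum_nonneg fun j _ => Matrix.pow_apply_nonneg hA k i j))
    (Finset.mem_range.2 (Nat.pos_of_ne_zero hn))
  simpa [neumannSum] using h

lemma mulVec_neumannSum (A : Matrix ι ι ℝ) {R : ℝ} (hR : R ≠ 0) (n : ℕ) (i : ι) :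
    ∑ j, A i j * neumannSum A R n j =
      R * (neumannSum A R n i - 1 + R⁻¹ ^ n * ∑ j, (A ^ n) i j) := by
  have h1 : Matrix.mulVec A (neumannSum A R n) =
      R • ∑ k ∈ Finset.range n, R⁻¹ ^ (k + 1) • Matrix.mulVec (A ^ (k + 1)) (1 : ι → ℝ) := by
    rw [neumannSum, Matrix.mulVec_sum, Finset.smul_sum]
    refine Finset.sum_congr rfl fun k _ => ?_
    rw [Matrix.mulVec_smul, Matrix.mulVec_mulVec, ← pow_succ', smul_smul, pow_succ' R⁻¹,
      mul_inv_cancel_left₀ hR]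
  have h2 : (∑ k ∈ Finset.range n, R⁻¹ ^ (k + 1) • Matrix.mulVec (A ^ (k + 1)) (1 : ι → ℝ)) + 1 =
      neumannSum A R n + R⁻¹ ^ n • Matrix.mulVec (A ^ n) 1 := by
    rw [neumannSum, ← Finset.sum_range_succ, Finset.sum_range_succ' _ n]
    simp
  have h3 := congrFun h1 i
  have h4 := congrFun h2 i
  simp only [Matrix.mulVec, dotProduct, Pi.add_apply, Pi.smul_apply, smul_eq_mul,
    Pi.one_apply, mul_one] at h3 h4
  rw [h3]
  congr 1
  linarith

/-- Vectors satisfying `V (k + 1) ≤ A (V k) + O(N ^ k)` grow at most like `R ^ k` as soon as `R`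
exceeds both `N` and the spectral radius of `A`. -/
lemma exists_growth_upper_bound {A : Matrix ι ι ℝ} (hA : ∀ i j, 0 ≤ A i j) {R N C : ℝ}
    (hN : 0 < N) (hNR : N < R) (hC : 0 ≤ C) (hρ : specRad A < ENNReal.ofReal R) (V : ℕ → ι → ℝ)
    (hV : ∀ k i, V (k + 1) i ≤ ∑ j, A i j * V k j + C * N ^ k) :
    ∃ B, 0 ≤ B ∧ ∀ k i, V k i ≤ B * R ^ k := by
  have hR : 0 < R := hN.trans hNR
  obtain ⟨n, hn, hrow⟩ := exists_row_sum_pow_le hR hρ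
  obtain ⟨h, hh⟩ : ∃ h, h = neumannSum A R n := ⟨_, rfl⟩
  have h1 : ∀ i, 1 ≤ h i := fun i => hh ▸ one_le_neumannSum hA hR hn i
  have hAh : ∀ i, ∑ j, A i j * h j ≤ R * h i := by
    intro i
    rw [hh, mulVec_neumannSum A hR.ne']
    have : R⁻¹ ^ n * ∑ j, (A ^ n) i j ≤ 1 := by
      rw [inv_pow, inv_mul_le_iff₀ (by positivity), mul_one]
      exact hrow i
    gcongr
    linarith
  set C' := C / (R - N) with hC'
  have hRN : 0 < R - N := by linarith
  have hC'0 : 0 ≤ C' := by positivity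
  have hC'e : C' * (R - N) = C := div_mul_cancel₀ _ hRN.ne'
  set B := ∑ i, |V 0 i| + C' with hB
  have hB0 : 0 ≤ B := add_nonneg (Finset.sum_nonneg fun _ _ => abs_nonneg _) hC'0
  have key : ∀ k i, V k i ≤ (B * R ^ k - C' * N ^ k) * h i := by
    intro k
    induction k with
    | zero =>
      intro i
      have := Finset.single_le_sum (f := fun i => |V 0 i|) (fun _ _ => abs_nonneg _)
        (Finset.mem_univ i)
      rw [pow_zero, pow_zero, mul_one, mul_one, hB, add_sub_cancel_right]
      refine (le_abs_self _).trans (this.trans ?_)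
      exact le_mul_of_one_le_right (Finset.sum_nonneg fun _ _ => abs_nonneg _) (h1 i)
    | succ k ih =>
      intro i
      have hpos : 0 ≤ B * R ^ k - C' * N ^ k := by
        have : N ^ k ≤ R ^ k := by gcongr
        have h' : C' ≤ B := by
          rw [hB]; linarith [Finset.sum_nonneg fun i (_ : i ∈ Finset.univ) => abs_nonneg (V 0 i)]
        have : C' * N ^ k ≤ B * R ^ k := by gcongr
        linarith
      calc V (k + 1) i ≤ ∑ j, A i j * V k j + C * N ^ k := hV k i
        _ ≤ ∑ j, A i j * ((B * R ^ k - C' * N ^ k) * h j) + C * N ^ k := by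
          gcongr with j _
          · exact hA i j
          · exact ih j
        _ = (B * R ^ k - C' * N ^ k) * ∑ j, A i j * h j + C * N ^ k := by
          rw [Finset.mul_sum]; congr 1; exact Finset.sum_congr rfl fun j _ => by ring
        _ ≤ (B * R ^ k - C' * N ^ k) * (R * h i) + (C * N ^ k) * h i := by
          exact add_le_add (mul_le_mul_of_nonneg_left (hAh i) hpos)
            (le_mul_of_one_le_right (by positivity) (h1 i))
        _ = (B * R ^ (k + 1) - C' * N ^ (k + 1)) * h i := by
          rw [← hC'e]; ring
  refine ⟨B * ∑ i, h i, mul_nonneg hB0 (Finset.sum_nonneg fun i _ => by linarith [h1 i]),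
    fun k i => (key k i).trans ?_⟩
  have hi : h i ≤ ∑ i, h i :=
    Finset.single_le_sum (fun i _ => by linarith [h1 i]) (Finset.mem_univ i)
  have h0 : 0 ≤ h i := by linarith [h1 i]
  calc (B * R ^ k - C' * N ^ k) * h i ≤ (B * R ^ k) * h i := by
        gcongr; linarith [show 0 ≤ C' * N ^ k by positivity]
    _ ≤ (B * R ^ k) * ∑ i, h i := by gcongr
    _ = _ := by ring

lemma exists_pow_le_col_sum {A : Matrix ι ι ℝ} (hA : ∀ i j, 0 ≤ A i j) {K : ℕ}
    (hK : ∀ i j, 0 < (A ^ K) i j) {R : ℝ} (hR : 0 < R) (hρ : ENNReal.ofReal R < specRad A) :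
    ∃ n ≠ 0, ∀ j, R ^ n ≤ ∑ i, (A ^ n) i j := by
  rcases isEmpty_or_nonempty ι with hι | hι
  · simp [specRad, spectralRadius, spectrum.of_subsingleton] at hρ
  obtain ⟨r', hRr, hr'⟩ : ∃ r : ℝ, R < r ∧ ENNReal.ofReal r < specRad A := by
    obtain ⟨y, hy1, hy2⟩ := exists_between hρ
    have hy : y ≠ ⊤ := ne_top_of_lt hy2
    refine ⟨y.toReal, (ENNReal.ofReal_lt_iff_lt_toReal hR.le hy).1 hy1, ?_⟩
    rwa [ENNReal.ofReal_toReal hy]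
  obtain ⟨p, hp⟩ := Finite.exists_min fun p : ι × ι => (A ^ K) p.1 p.2
  set c := (A ^ K) p.1 p.2
  have hc : 0 < c := hK _ _
  have hr0 : 0 < r' := hR.trans hRr
  obtain ⟨n, hn⟩ := pow_unbounded_of_one_lt (R ^ K / c) ((one_lt_div hR).2 hRr)
  refine ⟨n + 1 + K, by omega, fun j => ?_⟩
  have h1 : R ^ K * R ^ (n + 1) ≤ c * r' ^ (n + 1) := by
    have h2 : R ^ K / c ≤ (r' / R) ^ (n + 1) := hn.le.trans
      (pow_le_pow_right₀ ((one_le_div hR).2 hRr.le) n.le_succ)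
    rw [div_pow, div_le_div_iff₀ hc (by positivity)] at h2
    linarith
  calc R ^ (n + 1 + K) = R ^ K * R ^ (n + 1) := by ring
    _ ≤ c * r' ^ (n + 1) := h1
    _ ≤ c * ∑ i, ∑ l, (A ^ (n + 1)) i l := by
      gcongr; exact pow_le_sum_pow hA hr0 hr' n
    _ ≤ ∑ i, (A ^ (n + 1 + K)) i j := by
      rw [Finset.mul_sum]
      refine Finset.sum_le_sum fun i _ => ?_
      rw [pow_add A (n + 1) K, Matrix.mul_apply, Finset.mul_sum]
      refine Finset.sum_le_sum fun l _ => ?_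
      rw [mul_comm]
      exact mul_le_mul_of_nonneg_left (hp (l, j)) (Matrix.pow_apply_nonneg hA _ _ _)

/-- Nonnegative vectors satisfying `V (k + 1) ≥ A (V k) - O(N ^ k)` with `A` primitive that grow
faster than `N ^ k` grow at least like `R ^ k` for all `R` between `N` and the spectral radius. -/
lemma exists_growth_lower_bound {A : Matrix ι ι ℝ} (hA : ∀ i j, 0 ≤ A i j) {K : ℕ}
    (hK : ∀ i j, 0 < (A ^ K) i j) {R N C : ℝ}
    (hN : 0 < N) (hNR : N < R) (hC : 0 ≤ C) (hρ : ENNReal.ofReal R < specRad A) (V : ℕ → ι → ℝ)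
    (hV0 : ∀ k i, 0 ≤ V k i)
    (hV : ∀ k i, ∑ j, A i j * V k j ≤ V (k + 1) i + C * N ^ k)
    (hgrow : ∀ B : ℝ, ∃ k, B * N ^ k < ∑ i, V k i) :
    ∃ c > 0, ∃ k₀, ∀ k ≥ k₀, c * R ^ k ≤ ∑ i, V k i := by
  have hR : 0 < R := hN.trans hNR
  obtain ⟨n, hn, hcol⟩ := exists_pow_le_col_sum hA hK hR hρ
  have hAt : ∀ i j, 0 ≤ A.transpose i j := fun i j => hA j i
  obtain ⟨l, hl⟩ : ∃ l, l = neumannSum A.transpose R n := ⟨_, rfl⟩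
  have h1 : ∀ i, 1 ≤ l i := fun i => hl ▸ one_le_neumannSum hAt hR hn i
  have hAl : ∀ j, R * l j ≤ ∑ i, l i * A i j := by
    intro j
    have h := mulVec_neumannSum A.transpose hR.ne' n j
    rw [← hl, ← Matrix.transpose_pow] at h
    simp only [Matrix.transpose_apply] at h
    simp only [mul_comm (l _)]
    rw [h]
    have : 1 ≤ R⁻¹ ^ n * ∑ i, (A ^ n) i j := by
      rw [inv_pow, le_inv_mul_iff₀ (by positivity), mul_one]
      exact hcol j
    gcongr
    linarith
  set L := ∑ i, l i with hL
  have hL0 : 0 ≤ L := Finset.sum_nonneg fun i _ => by linarith [h1 i]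
  have hRN : 0 < R - N := by linarith
  set C' := C * L / (R - N) with hC'
  have hC'e : C' * (R - N) = C * L := div_mul_cancel₀ _ hRN.ne'
  have hstep : ∀ k, R * (∑ i, l i * V k i - C' * N ^ k) ≤
      ∑ i, l i * V (k + 1) i - C' * N ^ (k + 1) := by
    intro k
    have h2 : R * ∑ i, l i * V k i ≤ ∑ i, l i * V (k + 1) i + L * (C * N ^ k) := by
      calc R * ∑ i, l i * V k i = ∑ j, (R * l j) * V k j := by
            rw [Finset.mul_sum]; exact Finset.sum_congr rfl fun j _ => by ring
        _ ≤ ∑ j, (∑ i, l i * A i j) * V k j := by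
            refine Finset.sum_le_sum fun j _ => ?_
            exact mul_le_mul_of_nonneg_right (hAl j) (hV0 k j)
        _ = ∑ i, l i * ∑ j, A i j * V k j := by
            simp only [Finset.sum_mul, Finset.mul_sum]
            rw [Finset.sum_comm]
            exact Finset.sum_congr rfl fun i _ => Finset.sum_congr rfl fun j _ => by ring
        _ ≤ ∑ i, l i * (V (k + 1) i + C * N ^ k) := by
            refine Finset.sum_le_sum fun i _ => ?_
            exact mul_le_mul_of_nonneg_left (hV k i) (by linarith [h1 i])
        _ = _ := by simp only [mul_add, Finset.sum_add_distrib, ← Finset.sum_mul, hL]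
    have h3 : L * (C * N ^ k) = C' * (R - N) * N ^ k := by rw [hC'e]; ring
    rw [h3] at h2
    rw [pow_succ]
    nlinarith
  obtain ⟨k₀, hk₀⟩ := hgrow C'
  set d := ∑ i, l i * V k₀ i - C' * N ^ k₀ with hd
  have hd0 : 0 < d := by
    have : ∑ i, V k₀ i ≤ ∑ i, l i * V k₀ i :=
      Finset.sum_le_sum fun i _ => le_mul_of_one_le_left (hV0 k₀ i) (h1 i)
    linarith
  have hiter : ∀ s, d * R ^ s ≤ ∑ i, l i * V (k₀ + s) i - C' * N ^ (k₀ + s) := by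
    intro s
    induction s with
    | zero => simp [hd]
    | succ s ih =>
      refine le_trans ?_ (hstep (k₀ + s))
      rw [pow_succ]
      nlinarith [mul_le_mul_of_nonneg_left ih hR.le]
  have hC'0 : 0 ≤ C' := by positivity
  have hLpos : 0 < L + 1 := by linarith
  refine ⟨d / R ^ k₀ / (L + 1), by positivity, k₀, fun k hk => ?_⟩
  obtain ⟨s, rfl⟩ := Nat.exists_eq_add_of_le hk
  have h4 : ∑ i, l i * V (k₀ + s) i ≤ (L + 1) * ∑ i, V (k₀ + s) i := by
    rw [Finset.mul_sum]
    refine Finset.sum_le_sum fun i _ => mul_le_mul_of_nonneg_right ?_ (hV0 _ i)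
    have : l i ≤ L := Finset.single_le_sum (fun i _ => by linarith [h1 i]) (Finset.mem_univ i)
    linarith
  have h5 := hiter s
  have h6 : 0 ≤ C' * N ^ (k₀ + s) := by positivity
  rw [pow_add, show d / R ^ k₀ / (L + 1) * (R ^ k₀ * R ^ s) = d * R ^ s / (L + 1) by
    field_simp, div_le_iff₀ hLpos]
  linarith

end Matrices

section Recursion

variable {x0 y0 len : ℝ} {N : ℕ} {f S q : ℝ × ℝ → ℝ}

lemma oscil_cell_nonneg (hlen : 0 < len) (hN : 0 < N) (hf : ContinuousOn f (sqD x0 y0 len))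
    (u : List (Fin N × Fin N)) : 0 ≤ oscil f (cell x0 y0 len N u) := by
  obtain ⟨a, -, b, hb, h, he⟩ := exists_oscil_eq (isCompact_cell u) (cell_nonempty hlen u)
    (hf.mono (cell_subset_sqD hN u))
  rw [he]
  linarith [(h b hb).1]

lemma exists_selfAffine_error (hlen : 0 < len) (hN : 0 < N) {lamS lamq : ℝ} (hlamS : 0 < lamS)
    (hlamq : 0 < lamq) (hf : ContinuousOn f (sqD x0 y0 len))
    (hSlip : ∀ t₁ ∈ sqD x0 y0 len, ∀ t₂ ∈ sqD x0 y0 len, |S t₁ - S t₂| ≤ lamS * eudist t₁ t₂)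
    (hqlip : ∀ t₁ ∈ sqD x0 y0 len, ∀ t₂ ∈ sqD x0 y0 len, |q t₁ - q t₂| ≤ lamq * eudist t₁ t₂)
    (hself : ∀ w : Fin N × Fin N, ∀ t ∈ cell x0 y0 len N [w],
      f t = S t * f (LInv x0 y0 len N w t) + q t) :
    ∃ C, 0 ≤ C ∧ ∀ (a : Fin N × Fin N) (u : List (Fin N × Fin N)),
      ∀ s ∈ cell x0 y0 len N u, ∀ s' ∈ cell x0 y0 len N u,
      |f (Lmap x0 y0 len N a s) - f (Lmap x0 y0 len N a s')
        - S (Lmap x0 y0 len N a s) * (f s - f s')| ≤ C / N ^ u.length := by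
  have hNr : (1 : ℝ) ≤ N := by exact_mod_cast hN
  obtain ⟨F, hF⟩ := (isCompact_cell (x0 := x0) (y0 := y0) (len := len) (N := N)
    []).exists_bound_of_continuousOn hf
  have hF0 : 0 ≤ F := by
    obtain ⟨t, ht⟩ := cell_nonempty (x0 := x0) (y0 := y0) (N := N) hlen []
    exact (norm_nonneg _).trans (hF t ht)
  refine ⟨(lamS * F + lamq) * (2 * len), by positivity, fun a u s hs s' hs' => ?_⟩
  have hsD := cell_subset_sqD hN u hs
  have hsD' := cell_subset_sqD hN u hs'
  have e : ∀ t ∈ sqD x0 y0 len, f (Lmap x0 y0 len N a t) =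
      S (Lmap x0 y0 len N a t) * f t + q (Lmap x0 y0 len N a t) := fun t ht => by
    rw [hself a _ ⟨t, ht, rfl⟩, LInv_Lmap hN]
  rw [e s hsD, e s' hsD']
  have hd : eudist (Lmap x0 y0 len N a s) (Lmap x0 y0 len N a s') ≤ 2 * (len / N ^ u.length) := by
    refine (eudist_le_of_mem_cell hN (ws := a :: u) ⟨s, hs, rfl⟩ ⟨s', hs', rfl⟩).trans ?_
    gcongr
    simp
  have h1 := hSlip _ (Lmap_mapsTo hN a hsD) _ (Lmap_mapsTo hN a hsD')
  have h2 := hqlip _ (Lmap_mapsTo hN a hsD) _ (Lmap_mapsTo hN a hsD')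
  have h3 : |f s'| ≤ F := hF s' hsD'
  set t := Lmap x0 y0 len N a s
  set t' := Lmap x0 y0 len N a s'
  have hd0 : 0 ≤ eudist t t' := Real.sqrt_nonneg _
  calc |S t * f s + q t - (S t' * f s' + q t') - S t * (f s - f s')|
      = |(S t - S t') * f s' + (q t - q t')| := by ring_nf
    _ ≤ |S t - S t'| * |f s'| + |q t - q t'| := by
      rw [← abs_mul]; exact abs_add_le _ _
    _ ≤ (lamS * eudist t t') * F + lamq * eudist t t' := by gcongr
    _ = (lamS * F + lamq) * eudist t t' := by ring
    _ ≤ (lamS * F + lamq) * (2 * (len / N ^ u.length)) := by gcongr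
    _ = (lamS * F + lamq) * (2 * len) / N ^ u.length := by ring

lemma oscil_cons_le (hlen : 0 < len) (hN : 0 < N) (hf : ContinuousOn f (sqD x0 y0 len))
    (hS1 : ∀ t ∈ sqD x0 y0 len, |S t| < 1) {η : ℝ} {a : Fin N × Fin N}
    {u : List (Fin N × Fin N)} {E : Set (ℝ × ℝ)} (hE : cell x0 y0 len N (a :: u) ⊆ E)
    (hED : E ⊆ sqD x0 y0 len)
    (h : ∀ s ∈ cell x0 y0 len N u, ∀ s' ∈ cell x0 y0 len N u,
      |f (Lmap x0 y0 len N a s) - f (Lmap x0 y0 len N a s')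
        - S (Lmap x0 y0 len N a s) * (f s - f s')| ≤ η) :
    oscil f (cell x0 y0 len N (a :: u)) ≤ supAbs S E * oscil f (cell x0 y0 len N u) + η := by
  obtain ⟨_, ⟨s', hs', rfl⟩, _, ⟨s, hs, rfl⟩, -, he⟩ :=
    exists_oscil_eq (isCompact_cell (a :: u)) (cell_nonempty hlen (a :: u))
    (hf.mono (cell_subset_sqD hN (a :: u)))
  obtain ⟨b, -, c, -, hbc, he'⟩ := exists_oscil_eq (isCompact_cell u) (cell_nonempty hlen u)
    (hf.mono (cell_subset_sqD hN u))
  have h1 := (abs_le.1 (h s hs s' hs')).2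
  have h2 : |f s - f s'| ≤ oscil f (cell x0 y0 len N u) := by
    rw [he', abs_le]
    constructor <;> linarith [(hbc s hs).1, (hbc s hs).2, (hbc s' hs').1, (hbc s' hs').2]
  have h3 : |S (Lmap x0 y0 len N a s)| ≤ supAbs S E :=
    supAbs_mem_bound hS1 hED (hE ⟨s, hs, rfl⟩)
  have h4 := (le_abs_self _).trans
    ((abs_mul (S (Lmap x0 y0 len N a s)) (f s - f s')).trans_le
      (mul_le_mul h3 h2 (abs_nonneg _) (supAbs_nonneg S E)))
  rw [he]
  linarith

lemma infAbs_mul_oscil_le (hlen : 0 < len) (hN : 0 < N) (hf : ContinuousOn f (sqD x0 y0 len))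
    {η : ℝ} {a : Fin N × Fin N}
    {u : List (Fin N × Fin N)} {E : Set (ℝ × ℝ)} (hE : cell x0 y0 len N (a :: u) ⊆ E)
    (h : ∀ s ∈ cell x0 y0 len N u, ∀ s' ∈ cell x0 y0 len N u,
      |f (Lmap x0 y0 len N a s) - f (Lmap x0 y0 len N a s')
        - S (Lmap x0 y0 len N a s) * (f s - f s')| ≤ η) :
    infAbs S E * oscil f (cell x0 y0 len N u) ≤ oscil f (cell x0 y0 len N (a :: u)) + η := by
  obtain ⟨b, -, c, -, hbc, he⟩ :=
    exists_oscil_eq (isCompact_cell (a :: u)) (cell_nonempty hlen (a :: u))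
    (hf.mono (cell_subset_sqD hN (a :: u)))
  obtain ⟨s', hs', s, hs, hss, he'⟩ := exists_oscil_eq (isCompact_cell u) (cell_nonempty hlen u)
    (hf.mono (cell_subset_sqD hN u))
  have h0 : 0 ≤ f s - f s' := by linarith [(hss s hs).1]
  have h1 := h s hs s' hs'
  have m1 := hbc _ ⟨s, hs, rfl⟩
  have m2 := hbc _ ⟨s', hs', rfl⟩
  have h2 : |f (Lmap x0 y0 len N a s) - f (Lmap x0 y0 len N a s')| ≤
      oscil f (cell x0 y0 len N (a :: u)) := by
    rw [he, abs_le]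
    constructor <;> linarith [m1.1, m1.2, m2.1, m2.2]
  have h3 : infAbs S E ≤ |S (Lmap x0 y0 len N a s)| := infAbs_le (hE ⟨s, hs, rfl⟩)
  rw [he']
  calc infAbs S E * (f s - f s') ≤ |S (Lmap x0 y0 len N a s)| * (f s - f s') := by gcongr
    _ = |S (Lmap x0 y0 len N a s) * (f s - f s')| := by rw [abs_mul, abs_of_nonneg h0]
    _ ≤ _ := by
      have := abs_sub_abs_le_abs_sub (S (Lmap x0 y0 len N a s) * (f s - f s'))
        (f (Lmap x0 y0 len N a s) - f (Lmap x0 y0 len N a s'))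
      rw [abs_sub_comm (S _ * _)] at this
      linarith

lemma ofFn_append_singleton {A : Type*} {m : ℕ} (i : Fin (m + 1) → A) (a : A) :
    List.ofFn i ++ [a] = i 0 :: List.ofFn (Fin.snoc (α := fun _ => A) (Fin.tail i) a) := by
  rw [ofFn_snoc, List.ofFn_succ]
  rfl

lemma oscSum_nonneg (hlen : 0 < len) (hN : 0 < N) (hf : ContinuousOn f (sqD x0 y0 len))
    (p : List (Fin N × Fin N)) (k : ℕ) : 0 ≤ oscSum x0 y0 len N f p k :=
  Finset.sum_nonneg fun _ _ => oscil_cell_nonneg hlen hN hf _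

lemma sum_error_le (hN : 0 < N) {C : ℝ} (hC : 0 ≤ C) (m k : ℕ) :
    ∑ _a : Fin N × Fin N, ∑ _v : Fin k → Fin N × Fin N, C / (N : ℝ) ^ (m + 1 + k) ≤
      C * N * N ^ k := by
  have hNr : (1 : ℝ) ≤ N := by exact_mod_cast hN
  simp only [Finset.sum_const, Finset.card_univ, Fintype.card_prod, Fintype.card_fin,
    Fintype.card_fun, nsmul_eq_mul, Nat.cast_mul, Nat.cast_pow]
  calc (N : ℝ) * N * ((N * N) ^ k * (C / N ^ (m + 1 + k)))
      ≤ N * N * ((N * N) ^ k * (C / N ^ (1 + k))) := by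
        gcongr
        omega
    _ = C * N * N ^ k := by
        rw [mul_pow, pow_add]; field_simp

lemma oscSum_succ_le (hlen : 0 < len) (hN : 0 < N) (hf : ContinuousOn f (sqD x0 y0 len))
    (hS1 : ∀ t ∈ sqD x0 y0 len, |S t| < 1) {C : ℝ} (hC : 0 ≤ C)
    (hCe : ∀ (a : Fin N × Fin N) (u : List (Fin N × Fin N)),
      ∀ s ∈ cell x0 y0 len N u, ∀ s' ∈ cell x0 y0 len N u,
      |f (Lmap x0 y0 len N a s) - f (Lmap x0 y0 len N a s')
        - S (Lmap x0 y0 len N a s) * (f s - f s')| ≤ C / N ^ u.length)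
    (m k : ℕ) (i : Fin (m + 1) → Fin N × Fin N) :
    oscSum x0 y0 len N f (List.ofFn i) (k + 1) ≤
      ∑ j, upMat x0 y0 len N S m i j * oscSum x0 y0 len N f (List.ofFn j) k + C * N * N ^ k := by
  classical
  simp only [upMat, ite_mul, zero_mul]
  rw [sum_compatible, oscSum_succ]
  refine le_trans ?_ (add_le_add_right (sum_error_le hN hC m k) _)
  rw [← Finset.sum_add_distrib]
  refine Finset.sum_le_sum fun a _ => ?_
  rw [oscSum, oscSum, Finset.mul_sum, ← Finset.sum_add_distrib]
  refine Finset.sum_le_sum fun v _ => ?_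
  have hsub : cell x0 y0 len N (List.ofFn i ++ [a] ++ List.ofFn v) ⊆
      cell x0 y0 len N (List.ofFn i ++ [a]) := cell_append_subset hN _ _
  rw [Fin.snoc_last]
  rw [ofFn_append_singleton, List.cons_append] at hsub ⊢
  have h := hCe (i 0) (List.ofFn (Fin.snoc (α := fun _ => Fin N × Fin N) (Fin.tail i) a)
    ++ List.ofFn v)
  rw [List.length_append, List.length_ofFn, List.length_ofFn] at h
  exact oscil_cons_le hlen hN hf hS1 hsub (cell_subset_sqD hN _) h

lemma sum_lowMat_mul_oscSum_le (hlen : 0 < len) (hN : 0 < N)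
    (hf : ContinuousOn f (sqD x0 y0 len)) {C : ℝ} (hC : 0 ≤ C)
    (hCe : ∀ (a : Fin N × Fin N) (u : List (Fin N × Fin N)),
      ∀ s ∈ cell x0 y0 len N u, ∀ s' ∈ cell x0 y0 len N u,
      |f (Lmap x0 y0 len N a s) - f (Lmap x0 y0 len N a s')
        - S (Lmap x0 y0 len N a s) * (f s - f s')| ≤ C / N ^ u.length)
    (m k : ℕ) (i : Fin (m + 1) → Fin N × Fin N) :
    ∑ j, lowMat x0 y0 len N S m i j * oscSum x0 y0 len N f (List.ofFn j) k ≤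
      oscSum x0 y0 len N f (List.ofFn i) (k + 1) + C * N * N ^ k := by
  classical
  simp only [lowMat, ite_mul, zero_mul]
  rw [sum_compatible, oscSum_succ]
  refine le_trans ?_ (add_le_add_right (sum_error_le hN hC m k) _)
  rw [← Finset.sum_add_distrib]
  refine Finset.sum_le_sum fun a _ => ?_
  rw [oscSum, oscSum, Finset.mul_sum, ← Finset.sum_add_distrib]
  refine Finset.sum_le_sum fun v _ => ?_
  have hsub : cell x0 y0 len N (List.ofFn i ++ [a] ++ List.ofFn v) ⊆
      cell x0 y0 len N (List.ofFn i ++ [a]) := cell_append_subset hN _ _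
  rw [Fin.snoc_last]
  rw [ofFn_append_singleton, List.cons_append] at hsub ⊢
  have h := hCe (i 0) (List.ofFn (Fin.snoc (α := fun _ => Fin N × Fin N) (Fin.tail i) a)
    ++ List.ofFn v)
  rw [List.length_append, List.length_ofFn, List.length_ofFn] at h
  exact infAbs_mul_oscil_le hlen hN hf hsub h

lemma upMat_nonneg (m : ℕ) (i j : Fin (m + 1) → Fin N × Fin N) :
    0 ≤ upMat x0 y0 len N S m i j := by
  rw [upMat]
  split_ifs
  exacts [supAbs_nonneg _ _, le_rfl]

lemma lowMat_nonneg (m : ℕ) (i j : Fin (m + 1) → Fin N × Fin N) :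
    0 ≤ lowMat x0 y0 len N S m i j := by
  rw [lowMat]
  split_ifs
  exacts [infAbs_nonneg _ _, le_rfl]

lemma specRad_upMat_le (hN : 0 < N) (hS1 : ∀ t ∈ sqD x0 y0 len, |S t| < 1) (m : ℕ) :
    specRad (upMat x0 y0 len N S m) ≤ ENNReal.ofReal (N * N) := by
  classical
  refine specRad_le_of_row_sum_le (upMat_nonneg m) (by positivity) fun i => ?_
  simp only [upMat]
  rw [sum_compatible]
  refine (Finset.sum_le_sum fun a _ => supAbs_le_one hS1 (cell_subset_sqD hN _)).trans ?_
  simp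

lemma lowMat_pow_pos (hlen : 0 < len) (hN : 0 < N) (hS : ContinuousOn S (sqD x0 y0 len))
    (hS0 : ∀ t ∈ sqD x0 y0 len, S t ≠ 0) (m : ℕ) (i j : Fin (m + 1) → Fin N × Fin N) :
    0 < (lowMat x0 y0 len N S m ^ (m + 1)) i j := by
  have key : ∀ (k : ℕ) (i j : Fin (m + 1) → Fin N × Fin N),
      (∀ (t s : Fin (m + 1)), s.val = t.val + k → i s = j t) →
      0 < (lowMat x0 y0 len N S m ^ k) i j := by
    intro k
    induction k with
    | zero =>
      intro i j h
      have : i = j := funext fun t => h t t rfl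
      simp [this]
    | succ k ih =>
      intro i j h
      rw [pow_succ', Matrix.mul_apply]
      obtain ⟨l, hl⟩ : ∃ l : Fin (m + 1) → Fin N × Fin N, l =
          Fin.snoc (α := fun _ => Fin N × Fin N) (Fin.tail i) (j ⟨m - k, by omega⟩) := ⟨_, rfl⟩
      have hil : 0 < lowMat x0 y0 len N S m i l := by
        rw [lowMat, if_pos (fun t => by rw [hl, Fin.snoc_castSucc]; rfl)]
        exact infAbs_pos (isCompact_cell _) (cell_nonempty hlen _)
          (hS.mono (cell_subset_sqD hN _)) fun t ht => hS0 t (cell_subset_sqD hN _ ht)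
      have hlj : 0 < (lowMat x0 y0 len N S m ^ k) l j := by
        refine ih l j fun t s hst => ?_
        induction s using Fin.lastCases with
        | last =>
          rw [hl, Fin.snoc_last]
          congr 1
          ext
          simp at hst
          simp only
          omega
        | cast s =>
          rw [hl, Fin.snoc_castSucc]
          refine h t s.succ ?_
          simp at hst
          simp
          omega
      refine (mul_pos hil hlj).trans_le (Finset.single_le_sum
        (f := fun l => lowMat x0 y0 len N S m i l * (lowMat x0 y0 len N S m ^ k) l j)
        (fun l _ => mul_nonneg (lowMat_nonneg m i l)
          (Matrix.pow_apply_nonneg (lowMat_nonneg m) k l j)) (Finset.mem_univ l))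
  exact key (m + 1) i j fun t s hst => by have := s.isLt; omega

lemma exists_oscSum_le (hlen : 0 < len) (hN : 0 < N) (hf : ContinuousOn f (sqD x0 y0 len))
    (hS1 : ∀ t ∈ sqD x0 y0 len, |S t| < 1) {C : ℝ} (hC : 0 ≤ C)
    (hCe : ∀ (a : Fin N × Fin N) (u : List (Fin N × Fin N)),
      ∀ s ∈ cell x0 y0 len N u, ∀ s' ∈ cell x0 y0 len N u,
      |f (Lmap x0 y0 len N a s) - f (Lmap x0 y0 len N a s')
        - S (Lmap x0 y0 len N a s) * (f s - f s')| ≤ C / N ^ u.length)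
    {R : ℝ} (hNR : N < R) {m : ℕ} (hρ : specRad (upMat x0 y0 len N S m) < ENNReal.ofReal R) :
    ∃ B, 0 ≤ B ∧ ∀ᶠ p in Filter.atTop, oscSum x0 y0 len N f [] p ≤ B * R ^ p := by
  have hNr : (1 : ℝ) ≤ N := by exact_mod_cast hN
  obtain ⟨B, hB, h⟩ := exists_growth_upper_bound (upMat_nonneg m) (N := N) (C := C * N)
    (by linarith) hNR (by positivity) hρ (fun k i => oscSum x0 y0 len N f (List.ofFn i) k)
    (fun k i => oscSum_succ_le hlen hN hf hS1 hC hCe m k i)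
  refine ⟨Fintype.card (Fin (m + 1) → Fin N × Fin N) * B, by positivity, ?_⟩
  filter_upwards [Filter.eventually_ge_atTop (m + 1)] with p hp
  obtain ⟨k, rfl⟩ := Nat.exists_eq_add_of_le hp
  rw [← sum_oscSum_ofFn]
  refine (Finset.sum_le_sum fun i _ => h k i).trans ?_
  rw [Finset.sum_const, nsmul_eq_mul, Finset.card_univ, ← mul_assoc]
  have : R ^ k ≤ R ^ (m + 1 + k) := pow_le_pow_right₀ (by linarith) (by omega)
  gcongr

lemma exists_le_oscSum (hlen : 0 < len) (hN : 0 < N) (hf : ContinuousOn f (sqD x0 y0 len))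
    (hS : ContinuousOn S (sqD x0 y0 len)) (hS0 : ∀ t ∈ sqD x0 y0 len, S t ≠ 0)
    {C : ℝ} (hC : 0 ≤ C)
    (hCe : ∀ (a : Fin N × Fin N) (u : List (Fin N × Fin N)),
      ∀ s ∈ cell x0 y0 len N u, ∀ s' ∈ cell x0 y0 len N u,
      |f (Lmap x0 y0 len N a s) - f (Lmap x0 y0 len N a s')
        - S (Lmap x0 y0 len N a s) * (f s - f s')| ≤ C / N ^ u.length)
    (hgrow : ∀ C : ℝ, ∃ᶠ p in Filter.atTop, C < oscSum x0 y0 len N f [] p / (N : ℝ) ^ p)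
    {R : ℝ} (hNR : N < R) {m : ℕ} (hρ : ENNReal.ofReal R < specRad (lowMat x0 y0 len N S m)) :
    ∃ c > 0, ∀ᶠ p in Filter.atTop, c * R ^ p ≤ oscSum x0 y0 len N f [] p := by
  have hNr : (1 : ℝ) ≤ N := by exact_mod_cast hN
  obtain ⟨c, hc, k₀, h⟩ := exists_growth_lower_bound (lowMat_nonneg m)
    (lowMat_pow_pos hlen hN hS hS0 m) (N := N) (C := C * N) (by linarith) hNR (by positivity) hρ
    (fun k i => oscSum x0 y0 len N f (List.ofFn i) k)
    (fun k i => oscSum_nonneg hlen hN hf _ _)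
    (fun k i => sum_lowMat_mul_oscSum_le hlen hN hf hC hCe m k i) (fun B => by
      obtain ⟨p, hp, hpm⟩ :=
        ((hgrow |B|).and_eventually (Filter.eventually_ge_atTop (m + 1))).exists
      obtain ⟨k, rfl⟩ := Nat.exists_eq_add_of_le hpm
      refine ⟨k, ?_⟩
      rw [sum_oscSum_ofFn]
      rw [lt_div_iff₀ (by positivity)] at hp
      refine lt_of_le_of_lt ?_ hp
      gcongr
      · exact le_abs_self B
      · omega)
  have hR : 0 < R := by linarith
  refine ⟨c / R ^ (m + 1), by positivity, ?_⟩
  filter_upwards [Filter.eventually_ge_atTop (m + 1 + k₀)] with p hp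
  obtain ⟨k, rfl⟩ := Nat.exists_eq_add_of_le (show m + 1 ≤ p by omega)
  rw [← sum_oscSum_ofFn]
  refine le_trans (le_of_eq ?_) (h k (by omega))
  rw [pow_add R (m + 1) k]
  field_simp

end Recursion

section Counting

lemma card_Icc_ceil_floor_le {a b : ℝ} (hab : a ≤ b) :
    ((Finset.Icc ⌈a - 1⌉ ⌊b⌋).card : ℝ) ≤ b - a + 2 := by
  rw [Int.card_Icc, ← Int.cast_natCast, Int.toNat_eq_max, Int.cast_max]
  push_cast
  refine max_le ?_ (by linarith)
  linarith [Int.floor_le b, Int.le_ceil (a - 1)]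

lemma le_card_Icc_floor (a b : ℝ) : b - a ≤ ((Finset.Icc ⌊a⌋ ⌊b⌋).card : ℝ) := by
  rw [Int.card_Icc, ← Int.cast_natCast, Int.toNat_eq_max, Int.cast_max]
  push_cast
  refine le_max_of_le_left ?_
  linarith [Int.lt_floor_add_one b, Int.floor_le a]

lemma mem_Icc_ceil_floor {a b x ε : ℝ} (hε : 0 < ε) (hx : x ∈ Set.Icc a b) {n : ℤ}
    (hn : x ∈ Set.Icc (n * ε) ((n + 1) * ε)) : n ∈ Finset.Icc ⌈a / ε - 1⌉ ⌊b / ε⌋ := by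
  rw [Finset.mem_Icc, Int.ceil_le, Int.le_floor, sub_le_iff_le_add, div_le_iff₀ hε, le_div_iff₀ hε]
  exact ⟨hx.1.trans hn.2, hn.1.trans hx.2⟩

lemma max_mem_Icc_of_mem_Icc_floor {a b ε : ℝ} (hε : 0 < ε) (hab : a ≤ b) {n : ℤ}
    (hn : n ∈ Finset.Icc ⌊a / ε⌋ ⌊b / ε⌋) :
    max a (n * ε) ∈ Set.Icc a b ∧ max a (n * ε) ∈ Set.Icc (n * ε) ((n + 1) * ε) := by
  obtain ⟨h1, h2⟩ := Finset.mem_Icc.1 hn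
  rw [Int.le_floor, le_div_iff₀ hε] at h2
  have h3 : a < (n + 1) * ε := by
    rw [← div_lt_iff₀ hε]
    refine (Int.lt_floor_add_one _).trans_le ?_
    gcongr
  refine ⟨⟨le_max_left _ _, max_le hab h2⟩, le_max_right _ _, max_le h3.le ?_⟩
  gcongr
  linarith

lemma mem_Icc_floor_div {ε : ℝ} (hε : 0 < ε) (x : ℝ) :
    x ∈ Set.Icc (⌊x / ε⌋ * ε) ((⌊x / ε⌋ + 1) * ε) := by
  rw [Set.mem_Icc, ← le_div_iff₀ hε, ← div_le_iff₀ hε]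
  exact ⟨Int.floor_le _, (Int.lt_floor_add_one _).le⟩

/-- The closed cubes of the grid of mesh `ε`, indexed by their corners, that meet `E`. -/
def cubesMeeting (E : Set (ℝ × ℝ × ℝ)) (ε : ℝ) : Set (ℤ × ℤ × ℤ) :=
  {n : ℤ × ℤ × ℤ |
    (((Set.Icc ((n.1 : ℝ) * ε) (((n.1 : ℝ) + 1) * ε)) ×ˢ
      ((Set.Icc ((n.2.1 : ℝ) * ε) (((n.2.1 : ℝ) + 1) * ε)) ×ˢ
        (Set.Icc ((n.2.2 : ℝ) * ε) (((n.2.2 : ℝ) + 1) * ε)))) ∩ E).Nonempty}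

lemma cubeCount_eq_ncard (E : Set (ℝ × ℝ × ℝ)) (ε : ℝ) :
    cubeCount E ε = (cubesMeeting E ε).ncard := rfl

variable {x0 y0 len : ℝ} {N : ℕ} {f : ℝ × ℝ → ℝ}

lemma mem_cubesMeeting_graphOn {D : Set (ℝ × ℝ)} {ε : ℝ} {t : ℝ × ℝ} (ht : t ∈ D)
    {n : ℤ × ℤ × ℤ} (h1 : t.1 ∈ Set.Icc ((n.1 : ℝ) * ε) (((n.1 : ℝ) + 1) * ε))
    (h2 : t.2 ∈ Set.Icc ((n.2.1 : ℝ) * ε) (((n.2.1 : ℝ) + 1) * ε))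
    (h3 : f t ∈ Set.Icc ((n.2.2 : ℝ) * ε) (((n.2.2 : ℝ) + 1) * ε)) :
    n ∈ cubesMeeting (graphOn f D) ε :=
  ⟨(t.1, t.2, f t), ⟨h1, h2, h3⟩, ht, rfl⟩

lemma cubeCount_le (hlen : 0 < len) (hN : 0 < N) (hf : ContinuousOn f (sqD x0 y0 len)) {p : ℕ}
    {ε : ℝ} (hp : len / N ^ p ≤ ε) :
    (cubesMeeting (graphOn f (sqD x0 y0 len)) ε).Finite ∧
    (cubeCount (graphOn f (sqD x0 y0 len)) ε : ℝ) ≤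
      9 * (oscSum x0 y0 len N f [] p / ε + 2 * ((N : ℝ) ^ p) ^ 2) := by
  classical
  have hδ : 0 < len / (N : ℝ) ^ p := by positivity
  have hε : 0 < ε := hδ.trans_le hp
  choose a ha b hb hab he using fun w : Fin p → Fin N × Fin N =>
    exists_oscil_eq (isCompact_cell (x0 := x0) (y0 := y0) (len := len) (List.ofFn w))
      (cell_nonempty hlen _) (hf.mono (cell_subset_sqD hN _))
  set δ := len / (N : ℝ) ^ p with hδ'
  set k : (Fin p → Fin N × Fin N) → ℝ := fun w => gridIndex N ((List.ofFn w).map Prod.fst) with hk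
  set l : (Fin p → Fin N × Fin N) → ℝ := fun w => gridIndex N ((List.ofFn w).map Prod.snd) with hl
  let I : ℝ → ℝ → Finset ℤ := fun u v => Finset.Icc ⌈u / ε - 1⌉ ⌊v / ε⌋
  set T : Finset (ℤ × ℤ × ℤ) := Finset.univ.biUnion fun w : Fin p → Fin N × Fin N =>
    I (x0 + k w * δ) (x0 + (k w + 1) * δ) ×ˢ
      (I (y0 + l w * δ) (y0 + (l w + 1) * δ) ×ˢ I (f (a w)) (f (b w))) with hT
  have hsub : cubesMeeting (graphOn f (sqD x0 y0 len)) ε ⊆ T := by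
    rintro n ⟨⟨x, y, z⟩, ⟨h1, h2, h3⟩, hD, hz⟩
    obtain ⟨w, hw⟩ := exists_mem_cell hlen hN p hD
    obtain ⟨g1, g2⟩ := cell_subset_grid hN _ hw
    rw [List.length_ofFn] at g1 g2
    simp only at h1 h2 h3 hz g1 g2
    rw [hz] at h3
    simp only [hT, Finset.coe_biUnion, Set.mem_iUnion, Finset.mem_coe, Finset.mem_product]
    exact ⟨w, Finset.mem_univ _, mem_Icc_ceil_floor hε g1 h1, mem_Icc_ceil_floor hε g2 h2,
      mem_Icc_ceil_floor hε (hab w _ hw) h3⟩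
  refine ⟨T.finite_toSet.subset hsub, ?_⟩
  have h1 : (cubeCount (graphOn f (sqD x0 y0 len)) ε : ℝ) ≤ T.card := by
    rw [cubeCount_eq_ncard, ← Set.ncard_coe_finset]
    exact_mod_cast Set.ncard_le_ncard hsub T.finite_toSet
  have hI : ∀ u v : ℝ, u ≤ v → ((I u v).card : ℝ) ≤ (v - u) / ε + 2 := fun u v huv => by
    refine (card_Icc_ceil_floor_le (by gcongr)).trans (le_of_eq ?_)
    ring
  have hI3 : ∀ z j : ℝ, ((I (z + j * δ) (z + (j + 1) * δ)).card : ℝ) ≤ 3 := fun z j => by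
    refine (hI _ _ (by nlinarith)).trans ?_
    have : (z + (j + 1) * δ - (z + j * δ)) / ε ≤ 1 := by
      rw [div_le_one hε]; linarith
    linarith
  have h2 : (T.card : ℝ) ≤ ∑ w : Fin p → Fin N × Fin N,
      9 * (oscil f (cell x0 y0 len N (List.ofFn w)) / ε + 2) := by
    refine le_trans (Nat.cast_le.2 Finset.card_biUnion_le) ?_
    rw [Nat.cast_sum]
    refine Finset.sum_le_sum fun w _ => ?_
    rw [Finset.card_product, Finset.card_product, Nat.cast_mul, Nat.cast_mul, he w]
    have h3 := hI _ _ (hab w (b w) (hb w)).1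
    calc _ ≤ (3 : ℝ) * (3 * ((f (b w) - f (a w)) / ε + 2)) := by
          gcongr
          · exact hI3 _ _
          · exact hI3 _ _
      _ = _ := by ring
  refine h1.trans (h2.trans (le_of_eq ?_))
  rw [← Finset.mul_sum, Finset.sum_add_distrib, ← Finset.sum_div, oscSum]
  simp
  ring

lemma finite_cubesMeeting (hlen : 0 < len) (hf : ContinuousOn f (sqD x0 y0 len))
    {ε : ℝ} (hε : 0 < ε) : (cubesMeeting (graphOn f (sqD x0 y0 len)) ε).Finite := by
  obtain ⟨p, hp⟩ := pow_unbounded_of_one_lt (len / ε) (one_lt_two (α := ℝ))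
  refine (cubeCount_le (N := 2) (p := p) hlen two_pos hf ?_).1
  rw [div_lt_iff₀ hε] at hp
  push_cast
  rw [div_le_iff₀ (by positivity)]
  linarith

lemma oscSum_div_le_cubeCount (hlen : 0 < len) (hN : 0 < N)
    (hf : ContinuousOn f (sqD x0 y0 len)) {p : ℕ} {ε : ℝ} (hε : 0 < ε) (hp : ε ≤ len / N ^ p) :
    oscSum x0 y0 len N f [] p / ε ≤ 9 * cubeCount (graphOn f (sqD x0 y0 len)) ε := by
  classical
  have hδ : 0 < len / (N : ℝ) ^ p := by positivity
  choose a ha b hb hab he using fun w : Fin p → Fin N × Fin N =>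
    exists_oscil_eq (isCompact_cell (x0 := x0) (y0 := y0) (len := len) (List.ofFn w))
      (cell_nonempty hlen _) (hf.mono (cell_subset_sqD hN _))
  set δ := len / (N : ℝ) ^ p with hδ'
  set P : Finset (Σ _ : Fin p → Fin N × Fin N, ℤ) :=
    Finset.univ.sigma fun w => Finset.Icc ⌊f (a w) / ε⌋ ⌊f (b w) / ε⌋ with hP
  have hpt : ∀ z : (Σ _ : Fin p → Fin N × Fin N, ℤ), ∃ t : ℝ × ℝ, z ∈ P →
      t ∈ cell x0 y0 len N (List.ofFn z.1) ∧ f t ∈ Set.Icc (z.2 * ε) ((z.2 + 1) * ε) := by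
    rintro ⟨w, n⟩
    by_cases hz : (⟨w, n⟩ : Σ _ : Fin p → Fin N × Fin N, ℤ) ∈ P
    · obtain ⟨h1, h2⟩ := max_mem_Icc_of_mem_Icc_floor hε (hab w (b w) (hb w)).1
        (Finset.mem_sigma.1 hz).2
      obtain ⟨t, ht, hft⟩ := (isPreconnected_cell (List.ofFn w)).intermediate_value (ha w) (hb w)
        (hf.mono (cell_subset_sqD hN _)) h1
      exact ⟨t, fun _ => ⟨ht, hft ▸ h2⟩⟩
    · exact ⟨0, fun h => absurd h hz⟩
  choose t ht using hpt
  have hfin := finite_cubesMeeting hlen hf hε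
  have hcard : P.card ≤ 9 * hfin.toFinset.card := by
    refine Finset.card_le_mul_card_image_of_maps_to
      (f := fun z => (⌊(t z).1 / ε⌋, ⌊(t z).2 / ε⌋, z.2)) (fun z hz => ?_) 9 ?_
    · rw [hfin.mem_toFinset]
      exact mem_cubesMeeting_graphOn (cell_subset_sqD hN _ (ht z hz).1) (mem_Icc_floor_div hε _)
        (mem_Icc_floor_div hε _) (ht z hz).2
    · rintro n -
      let J : ℝ → ℤ → Finset ℤ := fun z m =>
        Finset.Icc ⌈(m * ε - z) / δ - 1⌉ ⌊((m + 1) * ε - z) / δ⌋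
      have hJ : ∀ z m, (J z m).card ≤ 3 := fun z m => by
        have h := card_Icc_ceil_floor_le (a := (m * ε - z) / δ) (b := ((m + 1) * ε - z) / δ)
          (by gcongr; linarith)
        have h' : ((m + 1) * ε - z) / δ - (m * ε - z) / δ ≤ 1 := by
          rw [← sub_div, div_le_one hδ]; linarith
        have : ((J z m).card : ℝ) ≤ 3 := h.trans (by linarith)
        exact_mod_cast this
      have hmem : ∀ (z x : ℝ) (j : ℕ), x ∈ Set.Icc (z + j * δ) (z + (j + 1) * δ) →
          (j : ℤ) ∈ J z ⌊x / ε⌋ := fun z x j hx => by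
        have hy := mem_Icc_floor_div hε x
        refine mem_Icc_ceil_floor (x := x - z) hδ
          ⟨by linarith [hy.1], by linarith [hy.2]⟩ ⟨?_, ?_⟩ <;> push_cast
        · linarith [hx.1]
        · linarith [hx.2]
      refine le_trans (Finset.card_le_card_of_injOn (t := J x0 n.1 ×ˢ J y0 n.2.1)
        (fun z => ((gridIndex N ((List.ofFn z.1).map Prod.fst) : ℤ),
          (gridIndex N ((List.ofFn z.1).map Prod.snd) : ℤ))) ?_ ?_) ?_
      · intro z hz
        obtain ⟨hzP, rfl⟩ := Finset.mem_filter.1 hz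
        obtain ⟨g1, g2⟩ := cell_subset_grid hN _ (ht z hzP).1
        rw [List.length_ofFn] at g1 g2
        exact Finset.mem_coe.2 (Finset.mem_product.2 ⟨hmem _ _ _ g1, hmem _ _ _ g2⟩)
      · rintro ⟨w, m⟩ hz ⟨w', m'⟩ hz' hzz
        have e1 := congrArg (fun n => n.2.2) (Finset.mem_filter.1 hz).2
        have e2 := congrArg (fun n => n.2.2) (Finset.mem_filter.1 hz').2
        simp only at e1 e2
        have e3 := gridIndex_injective _ _ (by simp) (Nat.cast_injective (congrArg Prod.fst hzz))
        have e4 := gridIndex_injective _ _ (by simp) (Nat.cast_injective (congrArg Prod.snd hzz))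
        simp only [List.map_ofFn] at e3 e4
        have e5 := List.ofFn_injective e3
        have e6 := List.ofFn_injective e4
        have : w = w' := funext fun r => Prod.ext (congrFun e5 r) (congrFun e6 r)
        rw [this, e1, e2]
      · rw [Finset.card_product]
        exact Nat.mul_le_mul (hJ _ _) (hJ _ _)
  have h1 : oscSum x0 y0 len N f [] p / ε ≤ P.card := by
    rw [hP, Finset.card_sigma, Nat.cast_sum, oscSum, Finset.sum_div]
    refine Finset.sum_le_sum fun w _ => ?_
    rw [List.nil_append, he w, sub_div]
    exact le_card_Icc_floor _ _
  refine h1.trans ?_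
  rw [cubeCount_eq_ncard, Set.ncard_eq_toFinset_card _ hfin]
  exact_mod_cast hcard

lemma sq_div_le_cubeCount (hlen : 0 < len) (hf : ContinuousOn f (sqD x0 y0 len)) {ε : ℝ}
    (hε : 0 < ε) : (len / ε) ^ 2 ≤ cubeCount (graphOn f (sqD x0 y0 len)) ε := by
  have hfin := finite_cubesMeeting hlen hf hε
  rw [cubeCount_eq_ncard, Set.ncard_eq_toFinset_card _ hfin]
  let I : ℝ → Finset ℤ := fun z => Finset.Icc ⌊z / ε⌋ ⌊(z + len) / ε⌋
  have hI : ∀ z, len / ε ≤ (I z).card := fun z => by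
    refine le_trans (le_of_eq ?_) (le_card_Icc_floor _ _)
    ring
  have hcard : (I x0 ×ˢ I y0).card ≤ hfin.toFinset.card := by
    refine Finset.card_le_card_of_injOn
      (fun n => (n.1, n.2, ⌊f (max x0 (n.1 * ε), max y0 (n.2 * ε)) / ε⌋)) ?_ ?_
    · intro n hn
      obtain ⟨h1, h2⟩ := Finset.mem_product.1 hn
      obtain ⟨a1, a2⟩ := max_mem_Icc_of_mem_Icc_floor hε (by linarith) h1
      obtain ⟨b1, b2⟩ := max_mem_Icc_of_mem_Icc_floor hε (by linarith) h2
      rw [Finset.mem_coe, hfin.mem_toFinset]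
      have ht : (max x0 (n.1 * ε), max y0 (n.2 * ε)) ∈ sqD x0 y0 len := ⟨a1, b1⟩
      exact mem_cubesMeeting_graphOn ht a2 b2 (mem_Icc_floor_div hε _)
    · intro n _ n' _ h
      simp only [Prod.mk.injEq] at h
      exact Prod.ext h.1 h.2.1
  calc (len / ε) ^ 2 = len / ε * (len / ε) := sq _
    _ ≤ (I x0).card * (I y0).card := by
      gcongr
      · exact hI x0
      · exact hI y0
    _ = ((I x0 ×ˢ I y0).card : ℝ) := by rw [Finset.card_product, Nat.cast_mul]
    _ ≤ _ := by exact_mod_cast hcard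

end Counting

section Dimension

lemma dim_bounds_of_cubeCount {E : Set (ℝ × ℝ × ℝ)} {c C d₁ d₂ : ℝ} (hc : 0 < c) (hC : 0 < C)
    (h₁ : ∀ᶠ ε in nhdsWithin (0 : ℝ) (Set.Ioi 0), c * (1 / ε) ^ d₁ ≤ cubeCount E ε)
    (h₂ : ∀ᶠ ε in nhdsWithin (0 : ℝ) (Set.Ioi 0), cubeCount E ε ≤ C * (1 / ε) ^ d₂) :
    d₁ ≤ lbDim E ∧ lbDim E ≤ ubDim E ∧ ubDim E ≤ d₂ := by
  set F := nhdsWithin (0 : ℝ) (Set.Ioi 0) with hF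
  have hL : Filter.Tendsto (fun ε : ℝ => Real.log (1 / ε)) F Filter.atTop := by
    simp only [one_div]
    exact Real.tendsto_log_atTop.comp tendsto_inv_nhdsGT_zero
  have ht : ∀ d b : ℝ, Filter.Tendsto (fun ε : ℝ => d + b / Real.log (1 / ε)) F (nhds d) := by
    intro d b
    simpa using tendsto_const_nhds.add (hL.const_div_atTop b)
  have hlow : ∀ᶠ ε in F, d₁ + Real.log c / Real.log (1 / ε) ≤
      Real.log (cubeCount E ε) / Real.log (1 / ε) := by
    filter_upwards [h₁, hL.eventually_gt_atTop 0, self_mem_nhdsWithin] with ε h hl hε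
    have hε' : 0 < 1 / ε := one_div_pos.2 hε
    rw [le_div_iff₀ hl, add_mul, div_mul_cancel₀ _ hl.ne', ← Real.log_rpow hε', add_comm,
      ← Real.log_mul hc.ne' (by positivity)]
    exact Real.log_le_log (by positivity) h
  have hup : ∀ᶠ ε in F, Real.log (cubeCount E ε) / Real.log (1 / ε) ≤
      d₂ + Real.log C / Real.log (1 / ε) := by
    filter_upwards [h₁, h₂, hL.eventually_gt_atTop 0, self_mem_nhdsWithin] with ε h h' hl hε
    have hε' : 0 < 1 / ε := one_div_pos.2 hε
    rw [div_le_iff₀ hl, add_mul, div_mul_cancel₀ _ hl.ne', ← Real.log_rpow hε', add_comm,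
      ← Real.log_mul hC.ne' (by positivity)]
    exact Real.log_le_log (lt_of_lt_of_le (by positivity) h) h'
  have hbb := (ht d₁ (Real.log c)).isBoundedUnder_ge.mono_ge hlow
  have hba := (ht d₂ (Real.log C)).isBoundedUnder_le.mono_le hup
  refine ⟨?_, Filter.liminf_le_limsup hba hbb, ?_⟩
  · rw [← (ht d₁ (Real.log c)).liminf_eq]
    exact Filter.liminf_le_liminf hlow (ht _ _).isBoundedUnder_ge hba.isCoboundedUnder_ge
  · rw [← (ht d₂ (Real.log C)).limsup_eq]
    exact Filter.limsup_le_limsup hup hbb.isCoboundedUnder_le (ht _ _).isBoundedUnder_le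

lemma eventually_exists_scale {len N : ℝ} (hlen : 0 < len) (hN : 1 < N) (p₀ : ℕ) :
    ∀ᶠ ε in nhdsWithin (0 : ℝ) (Set.Ioi 0),
      0 < ε ∧ ε ≤ 1 ∧ ∃ p ≥ p₀, N ^ p ≤ len / ε ∧ len / ε < N ^ (p + 1) := by
  have hpos : 0 < min 1 (len / N ^ (p₀ + 1)) := by positivity
  filter_upwards [self_mem_nhdsWithin, nhdsWithin_le_nhds (eventually_lt_nhds hpos)] with ε hε hε'
  have hε0 : 0 < ε := hε
  obtain ⟨h1, h2⟩ := lt_min_iff.1 hε'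
  rw [lt_div_iff₀ (by positivity), mul_comm, ← lt_div_iff₀ hε0] at h2
  obtain ⟨p, hp1, hp2⟩ := exists_nat_pow_near
    ((one_le_pow₀ hN.le).trans h2.le : 1 ≤ len / ε) hN
  refine ⟨hε0, h1.le, p, ?_, hp1, hp2⟩
  have := (pow_lt_pow_iff_right₀ hN).1 (h2.trans hp2)
  omega

lemma pow_eq_rpow_log_div_log {N R : ℝ} (hN : 1 < N) (hR : 0 < R) (p : ℕ) :
    R ^ p = (N ^ p) ^ (Real.log R / Real.log N) := by
  have h : N ^ (Real.log R / Real.log N) = R :=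
    Real.rpow_logb (by linarith) hN.ne' hR
  rw [← Real.rpow_natCast N p, ← Real.rpow_mul (by linarith), mul_comm, Real.rpow_mul (by linarith),
    h, Real.rpow_natCast]

variable {x0 y0 len : ℝ} {N : ℕ} {f : ℝ × ℝ → ℝ}

lemma exists_cubeCount_le (hlen : 0 < len) (hN : 1 < N) (hf : ContinuousOn f (sqD x0 y0 len))
    {B R : ℝ} (hB : 0 ≤ B) (hR : N ≤ R)
    (h : ∀ᶠ p in Filter.atTop, oscSum x0 y0 len N f [] p ≤ B * R ^ p) :
    ∃ C > 0, ∀ᶠ ε in nhdsWithin (0 : ℝ) (Set.Ioi 0),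
      (cubeCount (graphOn f (sqD x0 y0 len)) ε : ℝ) ≤
        C * (1 / ε) ^ (1 + Real.log R / Real.log N) := by
  have hNr : (1 : ℝ) < N := by exact_mod_cast hN
  have hlogN := Real.log_pos hNr
  set α := Real.log R / Real.log N with hα
  have hα1 : 1 ≤ α := by
    rw [hα, one_le_div hlogN]
    exact Real.log_le_log (by linarith) hR
  obtain ⟨p₀, hp₀⟩ := Filter.eventually_atTop.1 h
  refine ⟨9 * (B * (N * len) ^ α + 2 * (N * len) ^ 2), by positivity, ?_⟩
  filter_upwards [eventually_exists_scale hlen hNr p₀] with ε ⟨hε, hε1, p, hp, h1, h2⟩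
  have hpe : len / (N : ℝ) ^ (p + 1) ≤ ε := by
    rw [div_lt_iff₀ hε] at h2
    rw [div_le_iff₀ (by positivity)]
    linarith
  have h3 : (N : ℝ) ^ (p + 1) ≤ (N * len) * (1 / ε) := by
    rw [pow_succ']
    calc (N : ℝ) * N ^ p ≤ N * (len / ε) := by gcongr
      _ = _ := by ring
  have hε' : 1 ≤ 1 / ε := (one_le_div hε).2 hε1
  have hε0 : 0 < 1 / ε := by positivity
  have h4 : oscSum x0 y0 len N f [] (p + 1) ≤ B * ((N * len) ^ α * (1 / ε) ^ α) := by
    refine (hp₀ _ (by omega)).trans ?_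
    rw [pow_eq_rpow_log_div_log hNr (by linarith), ← Real.mul_rpow (by positivity) hε0.le]
    gcongr
  have h5 : ((N : ℝ) ^ (p + 1)) ^ 2 ≤ (N * len) ^ 2 * (1 / ε) ^ (1 + α) := by
    calc ((N : ℝ) ^ (p + 1)) ^ 2 ≤ ((N * len) * (1 / ε)) ^ 2 := by gcongr
      _ = (N * len) ^ 2 * (1 / ε) ^ (2 : ℝ) := by rw [mul_pow, Real.rpow_two]
      _ ≤ _ := by
        gcongr
        linarith
  calc (cubeCount (graphOn f (sqD x0 y0 len)) ε : ℝ)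
      ≤ 9 * (oscSum x0 y0 len N f [] (p + 1) / ε + 2 * ((N : ℝ) ^ (p + 1)) ^ 2) :=
        (cubeCount_le hlen (by omega) hf hpe).2
    _ ≤ 9 * (B * ((N * len) ^ α * (1 / ε) ^ α) / ε +
          2 * ((N * len) ^ 2 * (1 / ε) ^ (1 + α))) := by gcongr
    _ = _ := by
      rw [Real.rpow_add hε0, Real.rpow_one]; ring

lemma exists_le_cubeCount (hlen : 0 < len) (hN : 1 < N) (hf : ContinuousOn f (sqD x0 y0 len))
    {c R : ℝ} (hc : 0 < c) (hR : 1 ≤ R)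
    (h : ∀ᶠ p in Filter.atTop, c * R ^ p ≤ oscSum x0 y0 len N f [] p) :
    ∃ c' > 0, ∀ᶠ ε in nhdsWithin (0 : ℝ) (Set.Ioi 0),
      c' * (1 / ε) ^ (1 + Real.log R / Real.log N) ≤
        cubeCount (graphOn f (sqD x0 y0 len)) ε := by
  have hNr : (1 : ℝ) < N := by exact_mod_cast hN
  have hlogN := Real.log_pos hNr
  set α := Real.log R / Real.log N with hα
  have hα0 : 0 ≤ α := div_nonneg (Real.log_nonneg hR) hlogN.le
  obtain ⟨p₀, hp₀⟩ := Filter.eventually_atTop.1 h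
  refine ⟨c * (len / N) ^ α / 9, by positivity, ?_⟩
  filter_upwards [eventually_exists_scale hlen hNr p₀] with ε ⟨hε, hε1, p, hp, h1, h2⟩
  have hpe : ε ≤ len / (N : ℝ) ^ p := by
    rw [le_div_iff₀ hε] at h1
    rw [le_div_iff₀ (by positivity)]
    linarith
  have h3 : len / N * (1 / ε) ≤ (N : ℝ) ^ p := by
    rw [pow_succ] at h2
    rw [div_mul_div_comm, mul_one, mul_comm (N : ℝ), ← div_div, div_le_iff₀ (by positivity)]
    exact h2.le
  have hε0 : 0 < 1 / ε := by positivity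
  have h4 : c * ((len / N) ^ α * (1 / ε) ^ α) ≤ oscSum x0 y0 len N f [] p := by
    refine le_trans ?_ (hp₀ _ hp)
    rw [pow_eq_rpow_log_div_log hNr (by linarith), ← Real.mul_rpow (by positivity) hε0.le]
    gcongr
  have h5 := oscSum_div_le_cubeCount hlen (by omega) hf hε hpe
  have h6 : c * ((len / N) ^ α * (1 / ε) ^ α) / ε ≤ oscSum x0 y0 len N f [] p / ε := by gcongr
  rw [Real.rpow_add hε0, Real.rpow_one]
  have h7 : c * (len / N) ^ α / 9 * (1 / ε * (1 / ε) ^ α) =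
      c * ((len / N) ^ α * (1 / ε) ^ α) / ε / 9 := by ring
  rw [h7]
  linarith

lemma eventually_sq_le_cubeCount (hlen : 0 < len) (hf : ContinuousOn f (sqD x0 y0 len)) :
    ∀ᶠ ε in nhdsWithin (0 : ℝ) (Set.Ioi 0),
      len ^ 2 * (1 / ε) ^ (2 : ℝ) ≤ cubeCount (graphOn f (sqD x0 y0 len)) ε := by
  filter_upwards [self_mem_nhdsWithin] with ε hε
  refine le_trans (le_of_eq ?_) (sq_div_le_cubeCount hlen hf hε)
  rw [Real.rpow_two]
  ring

end Dimension

/-- if S has constant sign (so ρ_* = ρ^* =: ρ_S), then the box dimension of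
Γf equals 1 + log ρ_S / log N when ρ_S > N and the oscillation sums grow superlinearly;
otherwise it equals 2. -/
theorem box_dim_formula (x0 y0 len : ℝ) (hlen : 0 < len) (N : ℕ) (hN : 2 ≤ N)
    (f S q : ℝ × ℝ → ℝ) (lamS lamq : ℝ) (hlamS : 0 < lamS) (hlamq : 0 < lamq)
    (hf : ContinuousOn f (sqD x0 y0 len))
    (hSlip : ∀ t₁ ∈ sqD x0 y0 len, ∀ t₂ ∈ sqD x0 y0 len, |S t₁ - S t₂| ≤ lamS * eudist t₁ t₂)
    (hS1 : ∀ t ∈ sqD x0 y0 len, |S t| < 1)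
    (hqlip : ∀ t₁ ∈ sqD x0 y0 len, ∀ t₂ ∈ sqD x0 y0 len, |q t₁ - q t₂| ≤ lamq * eudist t₁ t₂)
    (hself : ∀ w : Fin N × Fin N, ∀ t ∈ cell x0 y0 len N [w],
      f t = S t * f (LInv x0 y0 len N w t) + q t)
    (hsign : (∀ t ∈ sqD x0 y0 len, 0 < S t) ∨ (∀ t ∈ sqD x0 y0 len, S t < 0)) :
    ∀ rhoS : ENNReal,
      Filter.Tendsto (fun m : ℕ => specRad (upMat x0 y0 len N S m)) Filter.atTop (nhds rhoS) →
      Filter.Tendsto (fun m : ℕ => specRad (lowMat x0 y0 len N S m)) Filter.atTop (nhds rhoS) →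
      ((((N : ℝ) < rhoS.toReal ∧ (∀ C : ℝ, ∃ᶠ p in Filter.atTop,
            C < oscSum x0 y0 len N f [] p / (N : ℝ) ^ p)) →
          lbDim (graphOn f (sqD x0 y0 len)) = 1 + Real.log rhoS.toReal / Real.log (N : ℝ) ∧
          ubDim (graphOn f (sqD x0 y0 len)) = 1 + Real.log rhoS.toReal / Real.log (N : ℝ)) ∧
        (¬ ((N : ℝ) < rhoS.toReal ∧ (∀ C : ℝ, ∃ᶠ p in Filter.atTop,
            C < oscSum x0 y0 len N f [] p / (N : ℝ) ^ p)) →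
          lbDim (graphOn f (sqD x0 y0 len)) = 2 ∧
          ubDim (graphOn f (sqD x0 y0 len)) = 2)) := by
  intro rhoS hup hlow
  have hN0 : 0 < N := by omega
  have hN1 : 1 < N := by omega
  have hNr : (1 : ℝ) < N := by exact_mod_cast hN1
  have hlogN := Real.log_pos hNr
  have hS := continuousOn_of_abs_sub_le_eudist hSlip
  have hS0 : ∀ t ∈ sqD x0 y0 len, S t ≠ 0 := by
    rcases hsign with h | h
    exacts [fun t ht => (h t ht).ne', fun t ht => (h t ht).ne]
  obtain ⟨C, hC, hCe⟩ := exists_selfAffine_error hlen hN0 hlamS hlamq hf hSlip hqlip hself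
  have hrho : rhoS ≠ ⊤ := ne_top_of_le_ne_top ENNReal.ofReal_ne_top
    (le_of_tendsto' hup fun m => specRad_upMat_le hN0 hS1 m)
  have hlen2 : 0 < len ^ 2 := by positivity
  have hsq := eventually_sq_le_cubeCount hlen hf
  have hupper : ∀ R : ℝ, N < R → rhoS.toReal < R → ∃ B > 0,
      ∀ᶠ ε in nhdsWithin (0 : ℝ) (Set.Ioi 0), (cubeCount (graphOn f (sqD x0 y0 len)) ε : ℝ) ≤
        B * (1 / ε) ^ (1 + Real.log R / Real.log N) := by
    intro R hNR hR
    obtain ⟨m, hm⟩ := (hup.eventually_lt_const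
      ((ENNReal.lt_ofReal_iff_toReal_lt hrho).2 hR)).exists
    obtain ⟨B, hB, h⟩ := exists_oscSum_le hlen hN0 hf hS1 hC hCe hNR hm
    exact exists_cubeCount_le hlen hN1 hf hB hNR.le h
  have hcont : ∀ r : ℝ, 0 < r → Filter.Tendsto (fun R : ℝ => 1 + Real.log R / Real.log N)
      (nhds r) (nhds (1 + Real.log r / Real.log N)) := fun r hr =>
    ((Real.continuousAt_log hr.ne').tendsto.div_const _).const_add 1
  have hone : 1 + Real.log N / Real.log N = 2 := by
    rw [div_self hlogN.ne']; norm_num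
  refine ⟨fun ⟨hNrho, hgrow⟩ => ?_, fun hnot => ?_⟩
  · have hdims : ∀ r R : ℝ, N < r → r < rhoS.toReal → rhoS.toReal < R →
        1 + Real.log r / Real.log N ≤ lbDim (graphOn f (sqD x0 y0 len)) ∧
        lbDim (graphOn f (sqD x0 y0 len)) ≤ ubDim (graphOn f (sqD x0 y0 len)) ∧
        ubDim (graphOn f (sqD x0 y0 len)) ≤ 1 + Real.log R / Real.log N := by
      intro r R hNr' hr hR
      obtain ⟨m, hm⟩ := (hlow.eventually_const_lt
        ((ENNReal.ofReal_lt_iff_lt_toReal (by linarith) hrho).2 hr)).exists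
      obtain ⟨c, hc, h⟩ := exists_le_oscSum hlen hN0 hf hS hS0 hC hCe hgrow hNr' hm
      obtain ⟨c', hc', h'⟩ := exists_le_cubeCount hlen hN1 hf hc (by linarith) h
      obtain ⟨B, hB, hB'⟩ := hupper R (by linarith) hR
      exact dim_bounds_of_cubeCount hc' hB h' hB'
    obtain ⟨r₀, hr₀, hr₀'⟩ := exists_between hNrho
    have hc := hcont rhoS.toReal (by linarith)
    have h1 : 1 + Real.log rhoS.toReal / Real.log N ≤ lbDim (graphOn f (sqD x0 y0 len)) := by
      refine le_of_tendsto (hc.mono_left (nhdsWithin_le_nhds (s := Set.Iio rhoS.toReal))) ?_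
      filter_upwards [self_mem_nhdsWithin, nhdsWithin_le_nhds (eventually_gt_nhds hNrho)]
        with r hr hr'
      exact (hdims r (rhoS.toReal + 1) hr' hr (by linarith)).1
    have h2 : ubDim (graphOn f (sqD x0 y0 len)) ≤ 1 + Real.log rhoS.toReal / Real.log N := by
      refine ge_of_tendsto (hc.mono_left (nhdsWithin_le_nhds (s := Set.Ioi rhoS.toReal))) ?_
      filter_upwards [self_mem_nhdsWithin] with R hR
      exact (hdims r₀ R hr₀ hr₀' hR).2.2
    have h3 := (hdims r₀ (rhoS.toReal + 1) hr₀ hr₀' (by linarith)).2.1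
    exact ⟨le_antisymm (h3.trans h2) h1, le_antisymm h2 (h1.trans h3)⟩
  · suffices h : 2 ≤ lbDim (graphOn f (sqD x0 y0 len)) ∧
        lbDim (graphOn f (sqD x0 y0 len)) ≤ ubDim (graphOn f (sqD x0 y0 len)) ∧
        ubDim (graphOn f (sqD x0 y0 len)) ≤ 2 from
      ⟨le_antisymm (h.2.1.trans h.2.2) h.1, le_antisymm h.2.2 (h.1.trans h.2.1)⟩
    by_cases hNrho : (N : ℝ) < rhoS.toReal
    · have hbdd : ∃ K : ℝ, ∀ᶠ p in Filter.atTop, oscSum x0 y0 len N f [] p / (N : ℝ) ^ p ≤ K := by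
        simpa [hNrho] using hnot
      obtain ⟨K, hK⟩ := hbdd
      obtain ⟨B, hB, hB'⟩ := exists_cubeCount_le (B := |K|) hlen hN1 hf (abs_nonneg K) le_rfl (by
        filter_upwards [hK] with p hp
        exact (div_le_iff₀ (by positivity)).1 (hp.trans (le_abs_self K)))
      rw [hone] at hB'
      exact dim_bounds_of_cubeCount hlen2 hB hsq hB'
    · have hdims : ∀ R : ℝ, N < R → 2 ≤ lbDim (graphOn f (sqD x0 y0 len)) ∧
          lbDim (graphOn f (sqD x0 y0 len)) ≤ ubDim (graphOn f (sqD x0 y0 len)) ∧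
          ubDim (graphOn f (sqD x0 y0 len)) ≤ 1 + Real.log R / Real.log N := by
        intro R hR
        obtain ⟨B, hB, hB'⟩ := hupper R hR (by linarith)
        exact dim_bounds_of_cubeCount hlen2 hB hsq hB'
      obtain ⟨h1, h2, -⟩ := hdims (N + 1) (by linarith)
      refine ⟨h1, h2, ?_⟩
      rw [← hone]
      refine ge_of_tendsto
        ((hcont N (by linarith)).mono_left (nhdsWithin_le_nhds (s := Set.Ioi (N : ℝ)))) ?_
      filter_upwards [self_mem_nhdsWithin] with R hR
      exact (hdims R hR).2.2
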